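/- arXiv:1805.06535 — 2 statements merged into one kernel-verified Lean document; each statement's English description precedes it below -/
import Mathlib

section
/- Let c > 0 be a constant such that c·∫₀^∞|u|² ≤ ∫₀^∞|u'|² + ∫₀^∞ x^β|u|² for every continuously differentiable u : [0,∞) → ℂ with u, u' square-integrable. If η ∈ ℂ with |η| < c and F : [0,∞) → ℂ is twice continuously differentiable with F, F', F'' square-integrable on (0,∞), F(0) = 0, and −F''(x) + i x^β F(x) − η F(x) = 0 for all x ≥ 0, then F is identically zero. (Consequently any nonzero solution, in particular the one normalized by F'(0) = 1, has F(0) ≠ 0.) -/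
open MeasureTheory Set
open scoped ComplexConjugate Topology
open Filter

/-- The exponent `1 + 2n + βk`. -/
noncomputable def solExp (β : ℝ) (n k : ℕ) : ℝ := 1 + 2 * n + β * k

/-- Coefficients of the formal solution
`∑ₙ ∑ₖ cₙₖ z ^ (1 + 2n + βk)` of `F'' = (i z ^ β - η) F`. -/
noncomputable def solCoeff (β : ℝ) (η : ℂ) : ℕ → ℕ → ℂ
  | 0, 0 => 1
  | 0, _ + 1 => 0
  | n + 1, 0 =>
    -η * solCoeff β η n 0 / ((solExp β (n + 1) 0 * (solExp β (n + 1) 0 - 1) : ℝ) : ℂ)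
  | n + 1, k + 1 => (Complex.I * solCoeff β η n k - η * solCoeff β η n (k + 1)) /
      ((solExp β (n + 1) (k + 1) * (solExp β (n + 1) (k + 1) - 1) : ℝ) : ℂ)

lemma solCoeff_eq_zero (β : ℝ) (η : ℂ) {n k : ℕ} (h : n < k) : solCoeff β η n k = 0 := by
  induction n generalizing k with
  | zero => obtain ⟨k, rfl⟩ := Nat.exists_eq_succ_of_ne_zero (by lia : k ≠ 0); simp [solCoeff]
  | succ n ih =>
    obtain ⟨k, rfl⟩ := Nat.exists_eq_succ_of_ne_zero (by lia : k ≠ 0)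
    simp [solCoeff, ih (by lia : n < k), ih (by lia : n < k + 1)]

lemma le_solExp {β : ℝ} (hβ : 0 ≤ β) (n k : ℕ) : 1 + 2 * (n : ℝ) ≤ solExp β n k := by
  have : 0 ≤ β * k := by positivity
  unfold solExp; linarith

lemma solExp_le {β : ℝ} (hβ : 0 ≤ β) {n k : ℕ} (h : k ≤ n) :
    solExp β n k ≤ 1 + (2 + β) * n := by
  have : β * k ≤ β * n := by gcongr
  unfold solExp; linarith

/-- The sum of the terms of level `n`, in the variable `w = log z`. -/
noncomputable def solTerm (β : ℝ) (η : ℂ) (n : ℕ) (w : ℂ) : ℂ :=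
  ∑ k ∈ Finset.range (n + 1), solCoeff β η n k * Complex.exp (solExp β n k * w)

/-- The derivative of `solTerm`. -/
noncomputable def solTermDeriv (β : ℝ) (η : ℂ) (n : ℕ) (w : ℂ) : ℂ :=
  ∑ k ∈ Finset.range (n + 1),
    solExp β n k * solCoeff β η n k * Complex.exp (solExp β n k * w)

/-- The coefficient of the equation in the variable `w = log z`. -/
noncomputable def logPotential (β : ℝ) (η : ℂ) (w : ℂ) : ℂ :=
  Complex.I * Complex.exp ((β + 2) * w) - η * Complex.exp (2 * w)

lemma hasDerivAt_cexp_mul (a c w : ℂ) :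
    HasDerivAt (fun w => a * Complex.exp (c * w)) (c * a * Complex.exp (c * w)) w := by
  have h := (((hasDerivAt_id w).const_mul c).cexp).const_mul a
  exact h.congr_deriv (by simp only [id]; ring)

lemma hasDerivAt_solTerm (β : ℝ) (η : ℂ) (n : ℕ) (w : ℂ) :
    HasDerivAt (solTerm β η n) (solTermDeriv β η n w) w := by
  have := HasDerivAt.fun_sum (u := Finset.range (n + 1))
    (fun k _ => hasDerivAt_cexp_mul (solCoeff β η n k) (solExp β n k) w)
  exact this

lemma hasDerivAt_solTermDeriv_zero (β : ℝ) (η : ℂ) (w : ℂ) :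
    HasDerivAt (solTermDeriv β η 0) (solTermDeriv β η 0 w) w := by
  have := hasDerivAt_cexp_mul 1 1 w
  convert this using 1
  · ext w; simp [solTermDeriv, solCoeff, solExp]
  · simp [solTermDeriv, solCoeff, solExp]

lemma hasDerivAt_solTermDeriv_succ {β : ℝ} (hβ : 0 ≤ β) (η : ℂ) (n : ℕ) (w : ℂ) :
    HasDerivAt (solTermDeriv β η (n + 1))
      (solTermDeriv β η (n + 1) w + logPotential β η w * solTerm β η n w) w := by
  have h := HasDerivAt.fun_sum (u := Finset.range (n + 1 + 1))
    (fun k _ => hasDerivAt_cexp_mul (solExp β (n + 1) k * solCoeff β η (n + 1) k)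
      (solExp β (n + 1) k) w)
  refine h.congr_deriv ?_
  have hne : ∀ k, (solExp β (n + 1) k : ℂ) * (solExp β (n + 1) k - 1) ≠ 0 := by
    intro k
    have h1 := le_solExp hβ (n + 1) k
    push_cast at h1
    have h2 : (0 : ℝ) ≤ n := n.cast_nonneg
    have : solExp β (n + 1) k * (solExp β (n + 1) k - 1) ≠ 0 :=
      mul_ne_zero (by linarith) (by linarith)
    exact_mod_cast this
  have key : ∑ k ∈ Finset.range (n + 1 + 1),
      (solExp β (n + 1) k : ℂ) * (solExp β (n + 1) k - 1) * solCoeff β η (n + 1) k *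
        Complex.exp (solExp β (n + 1) k * w) = logPotential β η w * solTerm β η n w := by
    have e2 : ∀ k, Complex.exp (solExp β (n + 1) k * w) =
        Complex.exp (2 * w) * Complex.exp (solExp β n k * w) := by
      intro k; rw [← Complex.exp_add]; congr 1; simp [solExp]; ring
    have e3 : ∀ k, Complex.exp (solExp β (n + 1) (k + 1) * w) =
        Complex.exp ((β + 2) * w) * Complex.exp (solExp β n k * w) := by
      intro k; rw [← Complex.exp_add]; congr 1; simp [solExp]; ring
    have e0 : ∑ k ∈ Finset.range (n + 1 + 1), solCoeff β η n k *
        Complex.exp (solExp β (n + 1) k * w) = Complex.exp (2 * w) * solTerm β η n w := by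
      rw [Finset.sum_range_succ, solCoeff_eq_zero β η (Nat.lt_succ_self n), zero_mul, add_zero,
        solTerm, Finset.mul_sum]
      refine Finset.sum_congr rfl fun k _ => ?_
      rw [e2]; ring
    have e1 : ∑ k ∈ Finset.range (n + 1), solCoeff β η n k *
        Complex.exp (solExp β (n + 1) (k + 1) * w)
          = Complex.exp ((β + 2) * w) * solTerm β η n w := by
      rw [solTerm, Finset.mul_sum]
      refine Finset.sum_congr rfl fun k _ => ?_
      rw [e3]; ring
    rw [Finset.sum_range_succ'] at e0
    rw [logPotential, sub_mul, mul_assoc, mul_assoc, ← e0, ← e1, Finset.sum_range_succ',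
      Finset.mul_sum, mul_add, Finset.mul_sum, ← sub_sub, ← Finset.sum_sub_distrib]
    refine Eq.trans (congrArg₂ (· + ·) (Finset.sum_congr rfl fun k _ => ?_) ?_)
      (sub_eq_add_neg _ _).symm
    · have := hne (k + 1)
      simp only [solCoeff]
      push_cast
      rw [mul_div_cancel₀ _ this]
      ring
    · have := hne 0
      simp only [solCoeff]
      push_cast
      rw [mul_div_cancel₀ _ this]
      ring
  rw [← key, solTermDeriv, ← Finset.sum_add_distrib]
  refine Finset.sum_congr rfl fun k _ => ?_
  ring

lemma sum_solExp_mul_norm_solCoeff_le {β : ℝ} (hβ : 0 ≤ β) (η : ℂ) (n : ℕ) :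
    ∑ k ∈ Finset.range (n + 1), solExp β n k * ‖solCoeff β η n k‖ ≤
      (1 + ‖η‖) ^ n / n.factorial := by
  induction n with
  | zero => simp [solExp, solCoeff]
  | succ n ih =>
    have hS : ∑ k ∈ Finset.range (n + 1), ‖solCoeff β η n k‖ ≤
        (1 + ‖η‖) ^ n / n.factorial := by
      refine le_trans (Finset.sum_le_sum fun k _ => ?_) ih
      have h1 := le_solExp hβ n k
      have h2 : (0 : ℝ) ≤ n := n.cast_nonneg
      exact le_mul_of_one_le_left (norm_nonneg _) (by linarith)
    have hb : ∀ (k : ℕ) (a : ℂ), solExp β (n + 1) k *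
        ‖a / ((solExp β (n + 1) k * (solExp β (n + 1) k - 1) : ℝ) : ℂ)‖ ≤ ‖a‖ / (n + 1) := by
      intro k a
      have h1 := le_solExp hβ (n + 1) k
      push_cast at h1
      have h2 : (0 : ℝ) ≤ n := n.cast_nonneg
      have h3 : 0 < solExp β (n + 1) k := by linarith
      have h4 : 0 < solExp β (n + 1) k - 1 := by linarith
      rw [norm_div, Complex.norm_real, Real.norm_of_nonneg (by positivity)]
      have : solExp β (n + 1) k * (‖a‖ / (solExp β (n + 1) k * (solExp β (n + 1) k - 1))) =
        ‖a‖ / (solExp β (n + 1) k - 1) := by field_simp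
      rw [this]
      gcongr
      linarith
    have hfin : ∑ k ∈ Finset.range (n + 1 + 1),
        solExp β (n + 1) k * ‖solCoeff β η (n + 1) k‖ ≤
        (1 + ‖η‖) / (n + 1) * ∑ k ∈ Finset.range (n + 1), ‖solCoeff β η n k‖ := by
      have hz : ∑ k ∈ Finset.range (n + 1), ‖solCoeff β η n k‖ =
          ∑ k ∈ Finset.range (n + 1), ‖solCoeff β η n (k + 1)‖ + ‖solCoeff β η n 0‖ := by
        rw [← Finset.sum_range_succ' (fun k => ‖solCoeff β η n k‖), Finset.sum_range_succ _ (n + 1),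
          solCoeff_eq_zero β η (Nat.lt_succ_self n), norm_zero, add_zero]
      calc _ ≤ ∑ k ∈ Finset.range (n + 1),
              (‖solCoeff β η n k‖ + ‖η‖ * ‖solCoeff β η n (k + 1)‖) / (n + 1)
              + ‖η‖ * ‖solCoeff β η n 0‖ / (n + 1) := by
            rw [Finset.sum_range_succ']
            refine add_le_add (Finset.sum_le_sum fun k _ => ?_) ?_
            · refine (hb (k + 1) _).trans ?_
              gcongr
              refine (norm_sub_le _ _).trans ?_
              simp
            · refine (hb 0 _).trans ?_
              simp
        _ = _ := by
            rw [← Finset.sum_div, Finset.sum_add_distrib, ← Finset.mul_sum]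
            linear_combination -‖η‖ / ((n : ℝ) + 1) * hz
    refine hfin.trans ?_
    calc _ ≤ (1 + ‖η‖) / (n + 1) * ((1 + ‖η‖) ^ n / n.factorial) := by gcongr
      _ = _ := by rw [Nat.factorial_succ]; push_cast; field_simp; ring

lemma norm_cexp_solExp_mul (β : ℝ) (n k : ℕ) (w : ℂ) :
    ‖Complex.exp (solExp β n k * w)‖ = Real.exp (solExp β n k * w.re) := by
  simp [Complex.norm_exp]

lemma norm_solTermDeriv_le_mul {β : ℝ} (hβ : 0 ≤ β) (η : ℂ) (n : ℕ) (w : ℂ) {b : ℝ}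
    (hb : ∀ k ≤ n, Real.exp (solExp β n k * w.re) ≤ b) :
    ‖solTermDeriv β η n w‖ ≤ (1 + ‖η‖) ^ n / n.factorial * b := by
  have hb0 : 0 ≤ b := (Real.exp_pos _).le.trans (hb 0 n.zero_le)
  refine (norm_sum_le _ _).trans ?_
  refine le_trans ?_ (mul_le_mul_of_nonneg_right (sum_solExp_mul_norm_solCoeff_le hβ η n) hb0)
  rw [Finset.sum_mul]
  refine Finset.sum_le_sum fun k hk => ?_
  have h1 := le_solExp hβ n k
  have h2 : (0 : ℝ) ≤ n := n.cast_nonneg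
  rw [norm_mul, norm_mul, norm_cexp_solExp_mul, Complex.norm_real,
    Real.norm_of_nonneg (by linarith)]
  have h3 : 0 ≤ solExp β n k := by linarith
  have := hb k (by simpa [Nat.lt_succ_iff] using hk)
  gcongr

lemma norm_solTerm_le_mul {β : ℝ} (hβ : 0 ≤ β) (η : ℂ) (n : ℕ) (w : ℂ) {b : ℝ}
    (hb : ∀ k ≤ n, Real.exp (solExp β n k * w.re) ≤ b) :
    ‖solTerm β η n w‖ ≤ (1 + ‖η‖) ^ n / n.factorial * b := by
  have hb0 : 0 ≤ b := (Real.exp_pos _).le.trans (hb 0 n.zero_le)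
  refine (norm_sum_le _ _).trans ?_
  refine le_trans ?_ (mul_le_mul_of_nonneg_right (sum_solExp_mul_norm_solCoeff_le hβ η n) hb0)
  rw [Finset.sum_mul]
  refine Finset.sum_le_sum fun k hk => ?_
  have h1 := le_solExp hβ n k
  have h2 : (0 : ℝ) ≤ n := n.cast_nonneg
  rw [norm_mul, norm_cexp_solExp_mul]
  exact mul_le_mul (le_mul_of_one_le_left (norm_nonneg _) (by linarith))
    (hb k (by simpa [Nat.lt_succ_iff] using hk)) (Real.exp_pos _).le
    (mul_nonneg (by linarith) (norm_nonneg _))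

/-- Majorant of the level `n` terms on the half plane `Re w < R`. -/
noncomputable def solMajorant (β : ℝ) (η : ℂ) (R : ℝ) (n : ℕ) : ℝ :=
  (1 + ‖η‖) ^ n / n.factorial * Real.exp ((1 + (2 + β) * n) * R)

lemma summable_solMajorant (β : ℝ) (η : ℂ) (R : ℝ) : Summable (solMajorant β η R) := by
  have h := (Real.summable_pow_div_factorial
    ((1 + ‖η‖) * Real.exp ((2 + β) * R))).mul_left (Real.exp R)
  refine h.congr fun n => ?_
  rw [solMajorant, mul_pow, ← Real.exp_nat_mul,
    show (1 + (2 + β) * n) * R = R + n * ((2 + β) * R) by ring, Real.exp_add]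
  ring

lemma exp_solExp_mul_le {β R : ℝ} (hβ : 0 ≤ β) (hR : 0 ≤ R) {n : ℕ} {w : ℂ} (hw : w.re < R) :
    ∀ k ≤ n, Real.exp (solExp β n k * w.re) ≤ Real.exp ((1 + (2 + β) * n) * R) := by
  intro k hk
  have h1 := le_solExp hβ n k
  have h2 : (0 : ℝ) ≤ n := n.cast_nonneg
  have h3 : 0 ≤ solExp β n k := by linarith
  exact Real.exp_le_exp.2 ((mul_le_mul_of_nonneg_left hw.le h3).trans
    (mul_le_mul_of_nonneg_right (solExp_le hβ hk) hR))

lemma summable_solTerm {β : ℝ} (hβ : 0 ≤ β) (η : ℂ) (w : ℂ) :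
    Summable fun n => solTerm β η n w :=
  .of_norm_bounded (summable_solMajorant β η (|w.re| + 1)) fun n =>
    norm_solTerm_le_mul hβ η n w
      (exp_solExp_mul_le hβ (by positivity) (by linarith [le_abs_self w.re]))

lemma summable_solTermDeriv {β : ℝ} (hβ : 0 ≤ β) (η : ℂ) (w : ℂ) :
    Summable fun n => solTermDeriv β η n w :=
  .of_norm_bounded (summable_solMajorant β η (|w.re| + 1)) fun n =>
    norm_solTermDeriv_le_mul hβ η n w
      (exp_solExp_mul_le hβ (by positivity) (by linarith [le_abs_self w.re]))

/-- The solution of `F'' = (i z ^ β - η) F`, `F 0 = 0`, `F' 0 = 1`, in the variable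
`w = log z`; it is an entire function of `w`. -/
noncomputable def logSol (β : ℝ) (η : ℂ) (w : ℂ) : ℂ := ∑' n, solTerm β η n w

/-- The derivative of `logSol`. -/
noncomputable def logSolDeriv (β : ℝ) (η : ℂ) (w : ℂ) : ℂ := ∑' n, solTermDeriv β η n w

lemma isOpen_re_lt (R : ℝ) : IsOpen {w : ℂ | w.re < R} :=
  isOpen_lt Complex.continuous_re continuous_const

lemma isPreconnected_re_lt (R : ℝ) : IsPreconnected {w : ℂ | w.re < R} :=
  (convex_halfSpace_re_lt R).isPreconnected

lemma hasDerivAt_logSol {β : ℝ} (hβ : 0 ≤ β) (η : ℂ) (w : ℂ) :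
    HasDerivAt (logSol β η) (logSolDeriv β η w) w := by
  have hw : w ∈ {z : ℂ | z.re < |w.re| + 1} := by
    simp only [mem_ofPred_eq]; linarith [le_abs_self w.re]
  exact hasDerivAt_tsum_of_isPreconnected (summable_solMajorant β η (|w.re| + 1))
    (isOpen_re_lt _) (isPreconnected_re_lt _) (fun n z _ => hasDerivAt_solTerm β η n z)
    (fun n z hz => norm_solTermDeriv_le_mul hβ η n z
      (exp_solExp_mul_le hβ (by positivity) hz)) hw (summable_solTerm hβ η w) hw

lemma norm_logPotential_le {β : ℝ} (hβ : 0 ≤ β) (η : ℂ) {w : ℂ} {R : ℝ} (hw : w.re < R) :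
    ‖logPotential β η w‖ ≤ Real.exp ((β + 2) * R) + ‖η‖ * Real.exp (2 * R) := by
  refine (norm_sub_le _ _).trans ?_
  simp only [norm_mul, Complex.norm_I, one_mul, Complex.norm_exp]
  gcongr
  · simp; gcongr
  · simp; exact hw.le

lemma hasDerivAt_logSolDeriv {β : ℝ} (hβ : 0 ≤ β) (η : ℂ) (w : ℂ) :
    HasDerivAt (logSolDeriv β η)
      (logSolDeriv β η w + logPotential β η w * logSol β η w) w := by
  set R := |w.re| + 1 with hR
  have hR0 : 0 ≤ R := by positivity
  set M := Real.exp ((β + 2) * R) + ‖η‖ * Real.exp (2 * R) with hM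
  have hw : w ∈ {z : ℂ | z.re < R} := by
    simp only [mem_ofPred_eq]; linarith [le_abs_self w.re]
  let g' : ℕ → ℂ → ℂ := fun n z => solTermDeriv β η n z +
    (match n with
      | 0 => 0
      | m + 1 => logPotential β η z * solTerm β η m z)
  let u : ℕ → ℝ := fun n => solMajorant β η R n +
    (match n with
      | 0 => 0
      | m + 1 => M * solMajorant β η R m)
  have hu : Summable u := by
    refine (summable_solMajorant β η R).add ?_
    rw [← summable_nat_add_iff 1]
    exact (summable_solMajorant β η R).mul_left M
  have h := hasDerivAt_tsum_of_isPreconnected (g := solTermDeriv β η) (g' := g') hu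
    (isOpen_re_lt R) (isPreconnected_re_lt R)
    (fun n z _ => by
      cases n with
      | zero => simpa [g'] using hasDerivAt_solTermDeriv_zero β η z
      | succ n => exact hasDerivAt_solTermDeriv_succ hβ η n z)
    (fun n z hz => by
      have h1 := norm_solTermDeriv_le_mul hβ η n z (exp_solExp_mul_le hβ hR0 hz)
      refine (norm_add_le _ _).trans (add_le_add h1 ?_)
      cases n with
      | zero => simp
      | succ n =>
        simp only [norm_mul]
        exact mul_le_mul (norm_logPotential_le hβ η hz)
          (norm_solTerm_le_mul hβ η n z (exp_solExp_mul_le hβ hR0 hz)) (norm_nonneg _)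
          (by positivity)) hw (summable_solTermDeriv hβ η w) hw
  refine h.congr_deriv ?_
  have hs : Summable fun n : ℕ => (match n with
      | 0 => (0 : ℂ)
      | m + 1 => logPotential β η w * solTerm β η m w) := by
    rw [← summable_nat_add_iff 1]
    exact (summable_solTerm hβ η w).mul_left _
  rw [(summable_solTermDeriv hβ η w).tsum_add hs, hs.tsum_eq_zero_add, zero_add, tsum_mul_left]
  rfl

lemma norm_tsum_sub_zero_le {u : ℕ → ℂ} {x b : ℝ} (hu : Summable u)
    (h : ∀ n, ‖u (n + 1)‖ ≤ x ^ (n + 1) / (n + 1).factorial * b) (hb : 0 ≤ b) :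
    ‖∑' n, u n - u 0‖ ≤ Real.exp x * b := by
  have hs := Real.summable_pow_div_factorial x
  have hs1 := (summable_nat_add_iff 1).2 hs
  rw [hu.tsum_eq_zero_add, add_sub_cancel_left]
  refine (tsum_of_norm_bounded (hs1.mul_right b).hasSum h).trans ?_
  rw [tsum_mul_right]
  refine mul_le_mul_of_nonneg_right ?_ hb
  rw [Real.exp_eq_exp_ℝ, NormedSpace.exp_eq_tsum_div]
  simp only [hs.tsum_eq_zero_add]
  simp

lemma exp_solExp_succ_mul_le {β : ℝ} (hβ : 0 ≤ β) (n : ℕ) {w : ℂ} (hw : w.re ≤ 0) :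
    ∀ k ≤ n + 1, Real.exp (solExp β (n + 1) k * w.re) ≤ Real.exp (3 * w.re) := by
  intro k _
  have h1 := le_solExp hβ (n + 1) k
  have h2 : (0 : ℝ) ≤ n := n.cast_nonneg
  push_cast at h1
  exact Real.exp_le_exp.2 (mul_le_mul_of_nonpos_right (by linarith) hw)

lemma norm_logSol_sub_exp_le {β : ℝ} (hβ : 0 ≤ β) (η : ℂ) {w : ℂ} (hw : w.re ≤ 0) :
    ‖logSol β η w - Complex.exp w‖ ≤ Real.exp (1 + ‖η‖) * Real.exp (3 * w.re) := by
  have h0 : solTerm β η 0 w = Complex.exp w := by simp [solTerm, solCoeff, solExp]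
  rw [← h0]
  exact norm_tsum_sub_zero_le (summable_solTerm hβ η w)
    (fun n => norm_solTerm_le_mul hβ η (n + 1) w (exp_solExp_succ_mul_le hβ n hw))
    (by positivity)

lemma norm_logSolDeriv_sub_exp_le {β : ℝ} (hβ : 0 ≤ β) (η : ℂ) {w : ℂ} (hw : w.re ≤ 0) :
    ‖logSolDeriv β η w - Complex.exp w‖ ≤ Real.exp (1 + ‖η‖) * Real.exp (3 * w.re) := by
  have h0 : solTermDeriv β η 0 w = Complex.exp w := by simp [solTermDeriv, solCoeff, solExp]
  rw [← h0]
  exact norm_tsum_sub_zero_le (summable_solTermDeriv hβ η w)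
    (fun n => norm_solTermDeriv_le_mul hβ η (n + 1) w (exp_solExp_succ_mul_le hβ n hw))
    (by positivity)

/-- `G'' = Q G` on `(0, ∞)`, with `G' = G₁`. -/
structure IsSchrodingerSol (Q : ℝ → ℂ) (G G₁ : ℝ → ℂ) : Prop where
  hasDerivAt : ∀ r, 0 < r → HasDerivAt G (G₁ r) r
  hasDerivAt_deriv : ∀ r, 0 < r → HasDerivAt G₁ (Q r * G r) r

/-- The sesquilinear quantity `Re (κ conj(G) G')`. -/
noncomputable def energy (κ : ℂ) (G G₁ : ℝ → ℂ) (r : ℝ) : ℝ := (κ * (conj (G r) * G₁ r)).re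

lemma abs_energy_le (κ : ℂ) (G G₁ : ℝ → ℂ) (r : ℝ) :
    |energy κ G G₁ r| ≤ ‖κ‖ * (‖G r‖ * ‖G₁ r‖) := by
  refine (Complex.abs_re_le_norm _).trans_eq ?_
  simp

namespace IsSchrodingerSol

variable {Q G G₁ : ℝ → ℂ}

lemma hasDerivAt_energy (h : IsSchrodingerSol Q G G₁) (κ : ℂ) {r : ℝ} (hr : 0 < r) :
    HasDerivAt (energy κ G G₁) (κ.re * ‖G₁ r‖ ^ 2 + (κ * Q r).re * ‖G r‖ ^ 2) r := by
  have h1 : HasDerivAt (fun r => conj (G r)) (conj (G₁ r)) r := (h.hasDerivAt r hr).star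
  have h2 := (h1.mul (h.hasDerivAt_deriv r hr)).const_mul κ
  have h3 := Complex.reCLM.hasFDerivAt.comp_hasDerivAt r h2
  refine h3.congr_deriv ?_
  rw [← Complex.normSq_eq_norm_sq, ← Complex.normSq_eq_norm_sq, Complex.normSq_apply,
    Complex.normSq_apply]
  simp
  ring

lemma hasDerivAt_norm_sq (h : IsSchrodingerSol Q G G₁) {r : ℝ} (hr : 0 < r) :
    HasDerivAt (fun r => ‖G r‖ ^ 2) (2 * (conj (G r) * G₁ r).re) r := by
  have h1 : HasDerivAt (fun r => conj (G r)) (conj (G₁ r)) r := (h.hasDerivAt r hr).star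
  have h2 := Complex.reCLM.hasFDerivAt.comp_hasDerivAt r (h1.mul (h.hasDerivAt r hr))
  have : (fun r => ‖G r‖ ^ 2) = Complex.reCLM ∘ ((fun r => conj (G r)) * G) := by
    ext r
    rw [← Complex.normSq_eq_norm_sq, Complex.normSq_apply]
    simp
  rw [this]
  refine h2.congr_deriv ?_
  simp
  ring

lemma hasDerivAt_norm_deriv_sq (h : IsSchrodingerSol Q G G₁) {r : ℝ} (hr : 0 < r) :
    HasDerivAt (fun r => ‖G₁ r‖ ^ 2) (2 * (conj (G₁ r) * (Q r * G r)).re) r := by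
  have h1 : HasDerivAt (fun r => conj (G₁ r)) (conj (Q r * G r)) r :=
    (h.hasDerivAt_deriv r hr).star
  have h2 := Complex.reCLM.hasFDerivAt.comp_hasDerivAt r (h1.mul (h.hasDerivAt_deriv r hr))
  have : (fun r => ‖G₁ r‖ ^ 2) = Complex.reCLM ∘ ((fun r => conj (G₁ r)) * G₁) := by
    ext r
    rw [← Complex.normSq_eq_norm_sq, Complex.normSq_apply]
    simp
  rw [this]
  refine h2.congr_deriv ?_
  simp
  ring

end IsSchrodingerSol

lemma monotoneOn_Ici_of_hasDerivAt_nonneg {f f' : ℝ → ℝ} {X : ℝ}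
    (hf : ∀ r, X ≤ r → HasDerivAt f (f' r) r) (hf' : ∀ r, X ≤ r → 0 ≤ f' r) :
    MonotoneOn f (Ici X) :=
  monotoneOn_of_hasDerivWithinAt_nonneg (convex_Ici X)
    (fun r hr => (hf r hr).continuousAt.continuousWithinAt)
    (fun r hr => (hf r (interior_subset hr)).hasDerivWithinAt)
    (fun r hr => hf' r (interior_subset hr))

/-- The potential on a ray: `ω r ^ β - μ`. -/
noncomputable def rayPotential (β : ℝ) (ω μ : ℂ) (r : ℝ) : ℂ := ω * ((r ^ β : ℝ) : ℂ) - μ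

lemma norm_rayPotential_le {β : ℝ} (hβ : 0 ≤ β) {ω μ : ℂ} (hω : ‖ω‖ = 1) {r : ℝ} (hr : 1 ≤ r) :
    ‖rayPotential β ω μ r‖ ≤ (1 + ‖μ‖) * r ^ β := by
  have h1 : 1 ≤ r ^ β := Real.one_le_rpow hr hβ
  refine (norm_sub_le _ _).trans ?_
  rw [norm_mul, hω, Complex.norm_real, Real.norm_of_nonneg (by positivity)]
  nlinarith [norm_nonneg μ]

lemma rpow_half_mul_self {β r : ℝ} (hr : 0 < r) : r ^ (β / 2) * r ^ (β / 2) = r ^ β := by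
  rw [← Real.rpow_add hr]; congr 1; ring

lemma hasDerivAt_exp_mul_rpow (β a : ℝ) {r : ℝ} (hr : 0 < r) :
    HasDerivAt (fun r : ℝ => Real.exp (a * r ^ (β / 2 + 1)))
      (Real.exp (a * r ^ (β / 2 + 1)) * (a * ((β / 2 + 1) * r ^ (β / 2)))) r := by
  have h := ((Real.hasDerivAt_rpow_const (p := β / 2 + 1) (Or.inl hr.ne')).const_mul a).exp
  rwa [add_sub_cancel_right] at h

namespace IsSchrodingerSol

variable {β X : ℝ} {ω μ : ℂ} {G G₁ : ℝ → ℂ}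

lemma energy_deriv_ge (hβ : 0 ≤ β) (hω : 1 ≤ ω.re + ω.im) (hX1 : 1 ≤ X)
    (hX : 4 * ‖μ‖ ≤ X ^ β) {r : ℝ} (hr : X ≤ r) :
    ‖G₁ r‖ ^ 2 + r ^ β / 2 * ‖G r‖ ^ 2 ≤ (1 - Complex.I).re * ‖G₁ r‖ ^ 2 +
      ((1 - Complex.I) * rayPotential β ω μ r).re * ‖G r‖ ^ 2 := by
  have h1 : X ^ β ≤ r ^ β := Real.rpow_le_rpow (by linarith) hr hβ
  have h2 : r ^ β / 2 ≤ ((1 - Complex.I) * rayPotential β ω μ r).re := by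
    have e : ((1 - Complex.I) * rayPotential β ω μ r).re =
        (ω.re + ω.im) * r ^ β - (μ.re + μ.im) := by
      simp only [rayPotential, Complex.mul_re, Complex.sub_re, Complex.sub_im, Complex.mul_im,
        Complex.ofReal_re, Complex.ofReal_im, Complex.one_re, Complex.one_im, Complex.I_re,
        Complex.I_im]
      ring
    rw [e]
    have h3 := Complex.re_le_norm μ
    have h4 := Complex.im_le_norm μ
    have h5 : 0 ≤ r ^ β := Real.rpow_nonneg (by linarith) _
    nlinarith
  have h3 := mul_le_mul_of_nonneg_right h2 (sq_nonneg ‖G r‖)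
  simp only [Complex.sub_re, Complex.one_re, Complex.I_re, sub_zero, one_mul]
  linarith

lemma monotoneOn_energy (h : IsSchrodingerSol (rayPotential β ω μ) G G₁) (hβ : 0 ≤ β)
    (hω : 1 ≤ ω.re + ω.im) (hX1 : 1 ≤ X) (hX : 4 * ‖μ‖ ≤ X ^ β) :
    MonotoneOn (energy (1 - Complex.I) G G₁) (Ici X) := by
  refine monotoneOn_Ici_of_hasDerivAt_nonneg
    (fun r hr => h.hasDerivAt_energy _ (by linarith)) fun r hr => ?_
  have h0 : 0 < r := by linarith
  exact le_trans (by positivity) (energy_deriv_ge hβ hω hX1 hX hr)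

lemma norm_one_sub_I_le : ‖(1 - Complex.I : ℂ)‖ ≤ 2 :=
  (norm_sub_le _ _).trans (by norm_num)

/-- If the energy is nonpositive then it decays exponentially. -/
lemma neg_energy_le (h : IsSchrodingerSol (rayPotential β ω μ) G G₁) (hβ : 0 ≤ β)
    (hω : 1 ≤ ω.re + ω.im) (hX1 : 1 ≤ X) (hX : 4 * ‖μ‖ ≤ X ^ β)
    (hE : ∀ r, X ≤ r → energy (1 - Complex.I) G G₁ r ≤ 0) :
    ∃ C, 0 ≤ C ∧ ∀ r, X ≤ r → -energy (1 - Complex.I) G G₁ r ≤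
      C * Real.exp (-(1 / (β + 2)) * r ^ (β / 2 + 1)) := by
  set E := energy (1 - Complex.I) G G₁ with hEdef
  have hmono : MonotoneOn (fun r => E r * Real.exp (1 / (β + 2) * r ^ (β / 2 + 1))) (Ici X) := by
    refine monotoneOn_Ici_of_hasDerivAt_nonneg
      (fun r hr => (h.hasDerivAt_energy _ (by linarith)).mul
        (hasDerivAt_exp_mul_rpow β (1 / (β + 2)) (by linarith))) fun r hr => ?_
    have h0 : 0 < r := by linarith
    have h1 := energy_deriv_ge (G := G) (G₁ := G₁) hβ hω hX1 hX hr
    have h2 : |E r| ≤ 2 * (‖G r‖ * ‖G₁ r‖) :=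
      (abs_energy_le _ _ _ _).trans (by gcongr; exact norm_one_sub_I_le)
    rw [abs_of_nonpos (hE r hr)] at h2
    have h3 := rpow_half_mul_self (β := β) h0
    set s := r ^ (β / 2) with hs
    have hs0 : 0 < s := by positivity
    have h4 : 0 ≤ ((1 - Complex.I).re * ‖G₁ r‖ ^ 2 +
      ((1 - Complex.I) * rayPotential β ω μ r).re * ‖G r‖ ^ 2) + E r * (s / 2) := by
      rw [← h3] at h1
      nlinarith [sq_nonneg (‖G₁ r‖ - s * ‖G r‖), sq_nonneg ‖G₁ r‖,
        mul_le_mul_of_nonneg_right h2 hs0.le, sq_nonneg (s * ‖G r‖)]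
    have h5 : 1 / (β + 2) * ((β / 2 + 1) * s) = s / 2 := by field_simp
    rw [h5]
    have := mul_nonneg h4 (Real.exp_pos (1 / (β + 2) * r ^ (β / 2 + 1))).le
    linarith
  refine ⟨-E X * Real.exp (1 / (β + 2) * X ^ (β / 2 + 1)),
    mul_nonneg (by linarith [hE X le_rfl]) (Real.exp_pos _).le, fun r hr => ?_⟩
  have h1 := hmono (self_mem_Ici) hr hr
  simp only at h1
  rw [neg_mul (1 / (β + 2)), Real.exp_neg, ← div_eq_mul_inv, le_div_iff₀ (Real.exp_pos _)]
  linarith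

lemma norm_sq_le_neg_energy (h : IsSchrodingerSol (rayPotential β ω μ) G G₁) (hβ : 0 ≤ β)
    (hω : 1 ≤ ω.re + ω.im) (hX1 : 1 ≤ X) (hX : 4 * ‖μ‖ ≤ X ^ β)
    (hE : ∀ r, X ≤ r → energy (1 - Complex.I) G G₁ r ≤ 0) {r : ℝ} (hr : X ≤ r) :
    ‖G r‖ ^ 2 ≤ -2 * energy (1 - Complex.I) G G₁ r := by
  set E := energy (1 - Complex.I) G G₁ with hEdef
  have hge : ∀ r, X ≤ r → ‖G₁ r‖ ^ 2 + 1 / 2 * ‖G r‖ ^ 2 ≤ (1 - Complex.I).re * ‖G₁ r‖ ^ 2 +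
      ((1 - Complex.I) * rayPotential β ω μ r).re * ‖G r‖ ^ 2 := by
    intro r hr
    refine le_trans ?_ (energy_deriv_ge (G := G) (G₁ := G₁) hβ hω hX1 hX hr)
    have : 1 ≤ r ^ β := Real.one_le_rpow (by linarith) hβ
    gcongr
  by_contra! hlt
  have hmono : MonotoneOn (fun r => E r + 1 / 2 * ‖G r‖ ^ 2) (Ici X) := by
    refine monotoneOn_Ici_of_hasDerivAt_nonneg
      (fun r hr => (h.hasDerivAt_energy _ (by linarith)).add
        ((h.hasDerivAt_norm_sq (by linarith)).const_mul (1 / 2))) fun r hr => ?_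
    have h1 := hge r hr
    have h2 : |(conj (G r) * G₁ r).re| ≤ ‖G r‖ * ‖G₁ r‖ :=
      (Complex.abs_re_le_norm _).trans_eq (by simp)
    have h3 := (abs_le.1 h2).1
    nlinarith [sq_nonneg (‖G₁ r‖ - 1 / 2 * ‖G r‖)]
  set a := E r + 1 / 2 * ‖G r‖ ^ 2 with ha
  have ha0 : 0 < a := by linarith
  have hlin : MonotoneOn (fun t => E t - a * t) (Ici r) := by
    refine monotoneOn_Ici_of_hasDerivAt_nonneg
      (fun t ht => (h.hasDerivAt_energy _ (by linarith)).sub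
        ((hasDerivAt_id t).const_mul a)) fun t ht => ?_
    have h1 := hge t (hr.trans ht)
    have h2 : a ≤ E t + 1 / 2 * ‖G t‖ ^ 2 := hmono hr (hr.trans ht : X ≤ t) ht
    have h3 := hE t (hr.trans ht)
    nlinarith [sq_nonneg ‖G₁ t‖]
  have hT : r ≤ r + (1 - E r) / a := by
    have := hE r hr
    have : 0 ≤ (1 - E r) / a := div_nonneg (by linarith) ha0.le
    linarith
  have h1 := hlin self_mem_Ici hT hT
  have h2 := hE _ (hr.trans hT)
  simp only at h1
  have h3 : a * (r + (1 - E r) / a) = a * r + (1 - E r) := by field_simp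
  linarith

/-- Decay of solutions with nonpositive energy, at a rate that does not depend on the ray. -/
lemma norm_le_exp (h : IsSchrodingerSol (rayPotential β ω μ) G G₁) (hβ : 0 ≤ β)
    (hω : 1 ≤ ω.re + ω.im) (hX1 : 1 ≤ X) (hX : 4 * ‖μ‖ ≤ X ^ β)
    (hE : ∀ r, X ≤ r → energy (1 - Complex.I) G G₁ r ≤ 0) :
    ∃ C, ∀ r, X ≤ r → ‖G r‖ ≤ C * Real.exp (-(1 / (2 * (β + 2))) * r ^ (β / 2 + 1)) := by
  obtain ⟨C, hC0, hC⟩ := h.neg_energy_le hβ hω hX1 hX hE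
  refine ⟨√(2 * C), fun r hr => ?_⟩
  refine abs_le_of_sq_le_sq' ?_ (by positivity) |>.2
  rw [mul_pow, Real.sq_sqrt (by positivity), ← Real.exp_nat_mul]
  have h1 := h.norm_sq_le_neg_energy hβ hω hX1 hX hE hr
  have h2 := hC r hr
  have h3 : ((2 : ℕ) : ℝ) * (-(1 / (2 * (β + 2))) * r ^ (β / 2 + 1)) =
      -(1 / (β + 2)) * r ^ (β / 2 + 1) := by
    push_cast; field_simp
  rw [h3]
  linarith

lemma tendsto_energy (h : IsSchrodingerSol (rayPotential β ω μ) G G₁) (hβ : 0 ≤ β)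
    (hω : 1 ≤ ω.re + ω.im) (hX1 : 1 ≤ X) (hX : 4 * ‖μ‖ ≤ X ^ β)
    (hE : ∀ r, X ≤ r → energy (1 - Complex.I) G G₁ r ≤ 0) :
    Tendsto (energy (1 - Complex.I) G G₁) atTop (𝓝 0) := by
  obtain ⟨C, hC0, hC⟩ := h.neg_energy_le hβ hω hX1 hX hE
  have h1 : Tendsto (fun r : ℝ => C * Real.exp (-(1 / (β + 2)) * r ^ (β / 2 + 1))) atTop
      (𝓝 0) := by
    have : Tendsto (fun r : ℝ => -(1 / (β + 2)) * r ^ (β / 2 + 1)) atTop atBot :=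
      (tendsto_rpow_atTop (by positivity)).const_mul_atTop_of_neg
        (by have : 0 < 1 / (β + 2) := by positivity
            linarith)
    simpa using (Real.tendsto_exp_atBot.comp this).const_mul C
  have h2 : Tendsto (fun r => -energy (1 - Complex.I) G G₁ r) atTop (𝓝 0) := by
    refine squeeze_zero' ?_ ?_ h1
    · filter_upwards [eventually_ge_atTop X] with r hr using by linarith [hE r hr]
    · filter_upwards [eventually_ge_atTop X] with r hr using hC r hr
  simpa using h2.neg

/-- A square integrable solution has nonpositive energy. -/
lemma energy_nonpos_of_integrableOn (h : IsSchrodingerSol (rayPotential β ω μ) G G₁) (hβ : 0 ≤ β)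
    (hω : 1 ≤ ω.re + ω.im) (hX1 : 1 ≤ X) (hX : 4 * ‖μ‖ ≤ X ^ β)
    (hG : IntegrableOn (fun r => ‖G r‖ ^ 2) (Ioi 0))
    (hG₁ : IntegrableOn (fun r => ‖G₁ r‖ ^ 2) (Ioi 0)) {r : ℝ} (hr : X ≤ r) :
    energy (1 - Complex.I) G G₁ r ≤ 0 := by
  by_contra! hpos
  have hr0 : 0 < r := by linarith
  have hInt : IntegrableOn (fun t => ‖G t‖ ^ 2 + ‖G₁ t‖ ^ 2) (Ioi r) :=
    (hG.add hG₁).mono_set (Ioi_subset_Ioi hr0.le)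
  have hconst : IntegrableOn (fun _ : ℝ => energy (1 - Complex.I) G G₁ r) (Ioi r) := by
    refine hInt.mono' aestronglyMeasurable_const ?_
    refine (ae_restrict_iff' measurableSet_Ioi).2 (ae_of_all _ fun t (ht : r < t) => ?_)
    rw [Real.norm_of_nonneg hpos.le]
    have h1 := h.monotoneOn_energy hβ hω hX1 hX hr (hr.trans ht.le : X ≤ t) ht.le
    have h2 : |energy (1 - Complex.I) G G₁ t| ≤ 2 * (‖G t‖ * ‖G₁ t‖) :=
      (abs_energy_le _ _ _ _).trans (by gcongr; exact norm_one_sub_I_le)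
    nlinarith [sq_nonneg (‖G t‖ - ‖G₁ t‖), le_abs_self (energy (1 - Complex.I) G G₁ t)]
  rw [integrableOn_const_iff] at hconst
  rcases hconst with hc | hc
  · exact hpos.ne' (enorm_eq_zero.1 hc)
  · simp at hc

/-- An exponentially decaying solution has nonpositive energy. -/
lemma energy_nonpos_of_norm_le_exp (h : IsSchrodingerSol (rayPotential β ω μ) G G₁) (hβ : 0 ≤ β)
    (hω1 : ‖ω‖ = 1) (hω : 1 ≤ ω.re + ω.im) (hX1 : 1 ≤ X) (hX : 4 * ‖μ‖ ≤ X ^ β) {C d : ℝ}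
    (hd : 0 < d) (hG : ∀ r, X ≤ r → ‖G r‖ ≤ C * Real.exp (-d * r ^ (β / 2 + 1))) {r : ℝ}
    (hr : X ≤ r) :
    energy (1 - Complex.I) G G₁ r ≤ 0 := by
  have hr0 : 0 < r := by linarith
  have hexp : ∀ s : ℝ, Tendsto (fun t : ℝ => t ^ s * Real.exp (-d * t)) atTop (𝓝 0) :=
    fun s => tendsto_rpow_mul_exp_neg_mul_atTop_nhds_zero s d hd
  have hC : 0 ≤ C := by
    have := (norm_nonneg _).trans (hG r hr)
    exact nonneg_of_mul_nonneg_left this (Real.exp_pos _)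
  have hle : ∀ t, X ≤ t → ‖G t‖ ≤ C * Real.exp (-d * t) := by
    intro t ht
    refine (hG t ht).trans ?_
    have h1 : t ^ (1 : ℝ) ≤ t ^ (β / 2 + 1) :=
      Real.rpow_le_rpow_of_exponent_le (by linarith) (by linarith)
    rw [Real.rpow_one] at h1
    gcongr ?_ * Real.exp ?_
    nlinarith
  obtain ⟨M, hM0, hM⟩ : ∃ M, 0 ≤ M ∧ ∀ t, r ≤ t → ‖rayPotential β ω μ t * G t‖ ≤ M := by
    have h1 : ∀ᶠ t : ℝ in atTop, t ^ β * Real.exp (-d * t) < 1 :=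
      (hexp β).eventually_lt_const one_pos
    obtain ⟨T, hT⟩ := eventually_atTop.1 h1
    have hcont : ContinuousOn (fun t => rayPotential β ω μ t * G t) (Icc r (max r T)) := by
      intro t ht
      have ht0 : 0 < t := hr0.trans_le ht.1
      refine ContinuousAt.continuousWithinAt ?_
      refine ContinuousAt.mul ?_ (h.hasDerivAt t ht0).continuousAt
      unfold rayPotential
      have : ContinuousAt (fun t : ℝ => t ^ β) t := Real.continuousAt_rpow_const _ _ (Or.inl ht0.ne')
      fun_prop
    obtain ⟨M1, hM1⟩ := isCompact_Icc.exists_bound_of_continuousOn hcont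
    refine ⟨max M1 ((1 + ‖μ‖) * C), le_max_of_le_right (by positivity), fun t ht => ?_⟩
    rcases le_total t (max r T) with htT | htT
    · exact (hM1 t ⟨ht, htT⟩).trans (le_max_left _ _)
    · refine le_trans ?_ (le_max_right _ _)
      have h2 := norm_rayPotential_le (μ := μ) hβ hω1 (by linarith : 1 ≤ t)
      have h3 := hle t (hr.trans ht)
      have h4 := hT t ((le_max_right _ _).trans htT)
      have ht0 : 0 < t := by linarith
      rw [norm_mul]
      calc _ ≤ ((1 + ‖μ‖) * t ^ β) * (C * Real.exp (-d * t)) := by gcongr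
        _ = (1 + ‖μ‖) * C * (t ^ β * Real.exp (-d * t)) := by ring
        _ ≤ _ := mul_le_of_le_one_right (by positivity) h4.le
  have hG₁ : ∀ t, r ≤ t → ‖G₁ t‖ ≤ ‖G₁ r‖ + M * t := by
    intro t ht
    have h1 := (convex_Ici r).norm_image_sub_le_of_norm_hasDerivWithin_le
      (fun s (hs : r ≤ s) => (h.hasDerivAt_deriv s (hr0.trans_le hs)).hasDerivWithinAt)
      hM self_mem_Ici ht
    have h2 : ‖G₁ t‖ ≤ ‖G₁ r‖ + ‖G₁ t - G₁ r‖ := by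
      have := norm_add_le (G₁ r) (G₁ t - G₁ r)
      rwa [add_sub_cancel] at this
    rw [Real.norm_of_nonneg (by linarith)] at h1
    nlinarith
  have hlim : Tendsto (fun t : ℝ => 2 * (C * ‖G₁ r‖ * (t ^ (0 : ℝ) * Real.exp (-d * t)) +
      C * M * (t ^ (1 : ℝ) * Real.exp (-d * t)))) atTop (𝓝 0) := by
    simpa using (((hexp 0).const_mul (C * ‖G₁ r‖)).add ((hexp 1).const_mul (C * M))).const_mul 2
  refine ge_of_tendsto hlim ?_
  filter_upwards [eventually_ge_atTop r] with t ht
  have h1 := h.monotoneOn_energy hβ hω hX1 hX hr (hr.trans ht : X ≤ t) ht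
  have h2 : |energy (1 - Complex.I) G G₁ t| ≤ 2 * (‖G t‖ * ‖G₁ t‖) :=
    (abs_energy_le _ _ _ _).trans (by gcongr; exact norm_one_sub_I_le)
  refine h1.trans ((le_abs_self _).trans (h2.trans ?_))
  rw [Real.rpow_zero, Real.rpow_one]
  have h3 := hle t (hr.trans ht)
  have h4 := hG₁ t ht
  calc _ ≤ 2 * ((C * Real.exp (-d * t)) * (‖G₁ r‖ + M * t)) := by gcongr
    _ = _ := by ring

/-- A priori growth bound. -/
lemma norm_sq_le_exp (h : IsSchrodingerSol (rayPotential β ω μ) G G₁) (hβ : 0 ≤ β)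
    (hω : ‖ω‖ = 1) {r : ℝ} (hr : 1 ≤ r) :
    ‖G r‖ ^ 2 ≤ (‖G 1‖ ^ 2 + ‖G₁ 1‖ ^ 2) *
      Real.exp ((β + 2 + ‖μ‖) * r ^ (β / 2 + 1)) := by
  set K := β + 2 + ‖μ‖ with hK
  have hK0 : 0 ≤ K := by positivity
  have hmono : MonotoneOn (fun r : ℝ => -((r ^ β * ‖G r‖ ^ 2 + ‖G₁ r‖ ^ 2) *
      Real.exp (-K * r ^ (β / 2 + 1)))) (Ici 1) := by
    refine monotoneOn_Ici_of_hasDerivAt_nonneg (fun r hr =>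
      ((((Real.hasDerivAt_rpow_const (Or.inl (by linarith : r ≠ 0))).mul
        (h.hasDerivAt_norm_sq (by linarith))).add (h.hasDerivAt_norm_deriv_sq (by linarith))).mul
        (hasDerivAt_exp_mul_rpow β (-K) (by linarith))).neg) fun r hr => ?_
    have h0 : 0 < r := by linarith
    have hQ := norm_rayPotential_le (μ := μ) hβ hω hr
    have h3 := rpow_half_mul_self (β := β) h0
    set s := r ^ (β / 2) with hs
    have hs1 : 1 ≤ s := Real.one_le_rpow hr (by positivity)
    have hb : r ^ (β - 1) ≤ s * s * s := by
      rw [h3]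
      have : r ^ (β - 1) ≤ r ^ β := Real.rpow_le_rpow_of_exponent_le hr (by linarith)
      have h4 : 0 ≤ r ^ β := by positivity
      nlinarith
    have h1 : (conj (G r) * G₁ r).re ≤ ‖G r‖ * ‖G₁ r‖ :=
      (Complex.re_le_norm _).trans_eq (by simp)
    have h2 : (conj (G₁ r) * (rayPotential β ω μ r * G r)).re ≤
        ‖G₁ r‖ * ((1 + ‖μ‖) * (s * s) * ‖G r‖) := by
      refine (Complex.re_le_norm _).trans ?_
      rw [h3]
      simp only [norm_mul, RCLike.norm_conj]
      gcongr
    set V := r ^ β * ‖G r‖ ^ 2 + ‖G₁ r‖ ^ 2 with hV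
    set D := β * r ^ (β - 1) * ‖G r‖ ^ 2 + r ^ β * (2 * (conj (G r) * G₁ r).re) +
      2 * (conj (G₁ r) * (rayPotential β ω μ r * G r)).re with hD
    have hy : 2 * s * (‖G r‖ * ‖G₁ r‖) ≤ V := by
      rw [hV, ← h3]
      nlinarith [sq_nonneg (s * ‖G r‖ - ‖G₁ r‖)]
    have hDle : D ≤ K * s * V := by
      have a1 : β * r ^ (β - 1) * ‖G r‖ ^ 2 ≤ β * s * V := by
        calc _ ≤ β * (s * s * s) * ‖G r‖ ^ 2 := by gcongr
          _ = β * s * (s * s * ‖G r‖ ^ 2) := by ring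
          _ ≤ _ := by
            gcongr
            rw [hV, ← h3]
            linarith [sq_nonneg ‖G₁ r‖]
      have a2 : r ^ β * (2 * (conj (G r) * G₁ r).re) ≤ s * V := by
        rw [← h3]
        calc _ ≤ s * s * (2 * (‖G r‖ * ‖G₁ r‖)) := by gcongr
          _ = s * (2 * s * (‖G r‖ * ‖G₁ r‖)) := by ring
          _ ≤ _ := by gcongr
      have a3 : 2 * (conj (G₁ r) * (rayPotential β ω μ r * G r)).re ≤ (1 + ‖μ‖) * s * V := by
        calc _ ≤ 2 * (‖G₁ r‖ * ((1 + ‖μ‖) * (s * s) * ‖G r‖)) := by gcongr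
          _ = (1 + ‖μ‖) * s * (2 * s * (‖G r‖ * ‖G₁ r‖)) := by ring
          _ ≤ _ := by gcongr
      rw [hK]
      linarith
    have hV0 : 0 ≤ V := by positivity
    have h6 : K * s * V ≤ V * (K * ((β / 2 + 1) * s)) := by
      have : 0 ≤ V * K * s * (β / 2) := by positivity
      linarith
    have h7 := mul_nonneg (sub_nonneg.2 (hDle.trans h6))
      (Real.exp_pos (-K * r ^ (β / 2 + 1))).le
    change 0 ≤ -(D * Real.exp (-K * r ^ (β / 2 + 1)) +
      V * (Real.exp (-K * r ^ (β / 2 + 1)) * (-K * ((β / 2 + 1) * s))))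
    linarith
  have h1 := hmono (self_mem_Ici) hr hr
  simp only [Real.one_rpow, one_mul, mul_one, neg_le_neg_iff] at h1
  rw [neg_mul, Real.exp_neg, ← div_eq_mul_inv, div_le_iff₀ (Real.exp_pos _)] at h1
  have h2 : 1 ≤ r ^ β := Real.one_le_rpow hr hβ
  have h3 : Real.exp (-K) ≤ 1 := Real.exp_le_one_iff.2 (by linarith)
  calc ‖G r‖ ^ 2 ≤ r ^ β * ‖G r‖ ^ 2 + ‖G₁ r‖ ^ 2 := by nlinarith [sq_nonneg ‖G r‖, sq_nonneg ‖G₁ r‖]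
    _ ≤ _ := h1
    _ ≤ _ := by
      gcongr
      exact mul_le_of_le_one_right (by positivity) h3

end IsSchrodingerSol

/-- Phragmén–Lindelöf in the variable `w = log z`: an entire function of growth order `p` in `z`
that decays with order `p` on a ray also decays with order `p` on the neighbouring rays. -/
lemma exists_norm_le_exp_neg_of_line {f : ℂ → ℂ} (hf : Differentiable ℂ f) {p δ K C₀ C ψ : ℝ}
    (hp : 0 < p) (hδ : 0 < δ) (hK : 0 < K)
    (hgrow : ∀ w, ‖f w‖ ≤ C₀ * Real.exp (K * Real.exp (p * w.re)))
    (hdec : ∀ w : ℂ, w.im = -ψ → ‖f w‖ ≤ C * Real.exp (-δ * Real.exp (p * w.re)))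
    {s : ℝ} (hs0 : 0 ≤ s) (hs1 : p * s ≤ 1) (hs2 : K * (p * s) ≤ δ / 4) :
    ∃ C', ∀ w : ℂ, w.im = -(ψ + s) → ‖f w‖ ≤ C' * Real.exp (-(δ / 4) * Real.exp (p * w.re)) := by
  have hC₀ : 0 ≤ C₀ :=
    nonneg_of_mul_nonneg_left ((norm_nonneg _).trans (hgrow 0)) (Real.exp_pos _)
  set g : ℂ → ℂ := fun w =>
    f w * Complex.exp ((δ - K * Complex.I) * Complex.exp (p * (w + ψ * Complex.I))) with hg
  have hgn : ∀ w, ‖g w‖ = ‖f w‖ * Real.exp (Real.exp (p * w.re) *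
      (δ * Real.cos (p * (w.im + ψ)) + K * Real.sin (p * (w.im + ψ)))) := by
    intro w
    rw [hg, norm_mul, Complex.norm_exp]
    congr 2
    simp [Complex.exp_re, Complex.exp_im]
    ring
  have hgd : Differentiable ℂ g := by fun_prop
  have hbound : ∀ w : ℂ, -(ψ + Real.pi / (2 * p)) ≤ w.im → w.im ≤ -ψ →
      ‖g w‖ ≤ max C C₀ := by
    intro w hw1 hw2
    refine PhragmenLindelof.horizontal_strip hgd.diffContOnCl ⟨p, ?_, 2 * K + δ, ?_⟩ ?_ ?_ hw1 hw2
    · rw [show -ψ - -(ψ + Real.pi / (2 * p)) = Real.pi / (2 * p) by ring]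
      rw [div_div_eq_mul_div, mul_div_cancel_left₀ _ Real.pi_ne_zero]
      linarith
    · refine Asymptotics.IsBigO.of_bound C₀ (Eventually.of_forall fun z => ?_)
      rw [hgn, Real.norm_of_nonneg (Real.exp_pos _).le]
      have h1 : Real.exp (p * z.re) ≤ Real.exp (p * |z.re|) := by
        gcongr; exact le_abs_self _
      set a := Real.exp (p * z.re) with ha
      have ha0 : 0 < a := Real.exp_pos _
      have h2 := hgrow z
      have h3 : a * (δ * Real.cos (p * (z.im + ψ)) + K * Real.sin (p * (z.im + ψ))) ≤
          a * (δ + K) := by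
        gcongr
        · exact mul_le_of_le_one_right hδ.le (Real.cos_le_one _)
        · exact mul_le_of_le_one_right hK.le (Real.sin_le_one _)
      calc _ ≤ C₀ * Real.exp (K * a) * Real.exp (a * (δ + K)) := by gcongr
        _ = C₀ * Real.exp ((2 * K + δ) * a) := by
          rw [mul_assoc, ← Real.exp_add]; ring_nf
        _ ≤ _ := by gcongr
    · intro z hz
      rw [hgn, hz, show p * (-(ψ + Real.pi / (2 * p)) + ψ) = -(Real.pi / 2) by field_simp; ring,
        Real.cos_neg, Real.sin_neg, Real.cos_pi_div_two, Real.sin_pi_div_two]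
      refine le_trans ?_ (le_max_right _ _)
      refine (mul_le_mul_of_nonneg_right (hgrow z) (Real.exp_pos _).le).trans_eq ?_
      rw [mul_assoc, ← Real.exp_add]
      ring_nf
      simp
    · intro z hz
      rw [hgn, hz, neg_add_cancel, mul_zero, Real.cos_zero, Real.sin_zero]
      refine le_trans ?_ (le_max_left _ _)
      refine (mul_le_mul_of_nonneg_right (hdec z hz) (Real.exp_pos _).le).trans_eq ?_
      rw [mul_assoc, ← Real.exp_add]
      ring_nf
      simp
  refine ⟨max C C₀, fun w hw => ?_⟩
  have hsp : s ≤ Real.pi / (2 * p) := by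
    rw [le_div_iff₀ (by positivity)]
    linarith [Real.pi_gt_three]
  have h1 := hbound w (by linarith) (by linarith)
  rw [hgn, hw, show p * (-(ψ + s) + ψ) = -(p * s) by ring, Real.cos_neg, Real.sin_neg] at h1
  have hps : 0 ≤ p * s := by positivity
  have h2 : δ / 4 ≤ δ * Real.cos (p * s) + K * -Real.sin (p * s) := by
    have h3 := Real.sin_le hps
    have h4 := Real.one_sub_sq_div_two_le_cos (x := p * s)
    have h5 : 1 / 2 ≤ Real.cos (p * s) := by nlinarith
    nlinarith
  have h3 : ‖f w‖ * Real.exp (δ / 4 * Real.exp (p * w.re)) ≤ max C C₀ := by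
    refine le_trans ?_ h1
    refine mul_le_mul_of_nonneg_left (Real.exp_le_exp.2 ?_) (norm_nonneg _)
    rw [mul_comm (δ / 4)]
    exact mul_le_mul_of_nonneg_left h2 (Real.exp_pos _).le
  rwa [neg_mul, Real.exp_neg, ← div_eq_mul_inv, le_div_iff₀ (Real.exp_pos _)]

/-- The solution `logSol` along the ray `z = r e ^ (-iφ)`. -/
noncomputable def raySol (β : ℝ) (η : ℂ) (φ r : ℝ) : ℂ :=
  if 0 < r then logSol β η (Real.log r - φ * Complex.I) else 0

/-- The derivative of `raySol` with respect to `r`. -/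
noncomputable def raySolDeriv (β : ℝ) (η : ℂ) (φ r : ℝ) : ℂ :=
  if 0 < r then logSolDeriv β η (Real.log r - φ * Complex.I) / r
  else Complex.exp (-φ * Complex.I)

/-- The phase of the potential on the ray `z = r e ^ (-iφ)`. -/
noncomputable def rayPhase (β φ : ℝ) : ℂ :=
  Complex.exp ((Real.pi / 2 - (β + 2) * φ : ℝ) * Complex.I)

lemma norm_rayPhase (β φ : ℝ) : ‖rayPhase β φ‖ = 1 := Complex.norm_exp_ofReal_mul_I _

lemma one_le_rayPhase {β φ : ℝ} (hβ : 0 ≤ β) (hφ0 : 0 ≤ φ)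
    (hφ : φ ≤ Real.pi / (2 * (β + 2))) : 1 ≤ (rayPhase β φ).re + (rayPhase β φ).im := by
  rw [rayPhase, Complex.exp_ofReal_mul_I_re, Complex.exp_ofReal_mul_I_im]
  set θ := Real.pi / 2 - (β + 2) * φ with hθ
  have h1 : θ ≤ Real.pi / 2 := by
    have : 0 ≤ (β + 2) * φ := by positivity
    linarith
  have h2 : 0 ≤ θ := by
    rw [le_div_iff₀ (by positivity)] at hφ
    linarith
  have hc := Real.cos_nonneg_of_mem_Icc ⟨by linarith, h1⟩
  have hs := Real.sin_nonneg_of_nonneg_of_le_pi h2 (by linarith)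
  nlinarith [Real.sin_sq_add_cos_sq θ, mul_nonneg hc hs]

lemma logPotential_log_sub {β φ r : ℝ} (η : ℂ) (hr : 0 < r) :
    logPotential β η (Real.log r - φ * Complex.I) =
      r ^ 2 * rayPotential β (rayPhase β φ) (η * Complex.exp (-(2 * φ) * Complex.I)) r := by
  have hr' : (r : ℂ) ^ 2 = Complex.exp (2 * Real.log r) := by
    rw [← Complex.ofReal_pow, ← Real.exp_log (pow_pos hr 2), Complex.ofReal_exp, Real.log_pow]
    push_cast; rfl
  have hrβ : ((r ^ β : ℝ) : ℂ) = Complex.exp (Real.log r * β) := by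
    rw [Real.rpow_def_of_pos hr, Complex.ofReal_exp, Complex.ofReal_mul]
  have hI : Complex.exp (Real.pi / 2 * Complex.I) = Complex.I := by
    rw [Complex.exp_mul_I, ← Complex.ofReal_ofNat, ← Complex.ofReal_div, ← Complex.ofReal_cos,
      ← Complex.ofReal_sin]
    simp
  have h1 : Complex.exp (2 * Real.log r) *
      (Complex.exp ((Real.pi / 2 - (β + 2) * φ : ℝ) * Complex.I) * Complex.exp (Real.log r * β)) =
      Complex.I * Complex.exp ((β + 2) * (Real.log r - φ * Complex.I)) := by
    rw [← hI, ← Complex.exp_add, ← Complex.exp_add, ← Complex.exp_add, hI]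
    congr 1
    push_cast
    ring
  have h2 : Complex.exp (2 * Real.log r) * Complex.exp (-(2 * φ) * Complex.I) =
      Complex.exp (2 * (Real.log r - φ * Complex.I)) := by
    rw [← Complex.exp_add]
    congr 1
    ring
  rw [logPotential, rayPotential, rayPhase, hrβ, hr']
  linear_combination -h1 + η * h2

lemma isSchrodingerSol_raySol {β : ℝ} (hβ : 0 ≤ β) (η : ℂ) (φ : ℝ) :
    IsSchrodingerSol
      (rayPotential β (rayPhase β φ) (η * Complex.exp (-(2 * φ) * Complex.I)))
      (raySol β η φ) (raySolDeriv β η φ) := by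
  have hlog : ∀ r : ℝ, 0 < r →
      HasDerivAt (fun r : ℝ => (Real.log r - φ * Complex.I : ℂ)) ((r : ℂ)⁻¹) r := by
    intro r hr
    have := (Real.hasDerivAt_log hr.ne').ofReal_comp.sub_const (φ * Complex.I)
    rwa [Complex.ofReal_inv] at this
  constructor
  · intro r hr
    have h1 := (hasDerivAt_logSol hβ η (Real.log r - φ * Complex.I)).comp r (hlog r hr)
    have h2 : raySol β η φ =ᶠ[𝓝 r] logSol β η ∘ fun r : ℝ => (Real.log r - φ * Complex.I : ℂ) := by
      filter_upwards [lt_mem_nhds hr] with t ht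
      simp [raySol, ht]
    refine (h1.congr_of_eventuallyEq h2).congr_deriv ?_
    simp [raySolDeriv, hr, div_eq_mul_inv]
  · intro r hr
    have h1 := (hasDerivAt_logSolDeriv hβ η (Real.log r - φ * Complex.I)).comp r (hlog r hr)
    have hr' : (r : ℂ) ≠ 0 := Complex.ofReal_ne_zero.2 hr.ne'
    have h3 := h1.div (Complex.ofRealCLM.hasDerivAt (x := r)) hr'
    have h2 : raySolDeriv β η φ =ᶠ[𝓝 r] (logSolDeriv β η ∘
        fun r : ℝ => (Real.log r - φ * Complex.I : ℂ)) / fun r : ℝ => Complex.ofRealCLM r := by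
      filter_upwards [lt_mem_nhds hr] with t ht
      simp [raySolDeriv, ht]
    refine (h3.congr_of_eventuallyEq h2).congr_deriv ?_
    rw [logPotential_log_sub η hr]
    simp only [raySol, hr, if_true, Function.comp, Complex.ofRealCLM_apply, Complex.ofReal_one]
    field_simp
    ring

lemma re_log_sub (r φ : ℝ) : (Real.log r - φ * Complex.I : ℂ).re = Real.log r := by
  simp

lemma exp_log_sub {r : ℝ} (hr : 0 < r) (φ : ℝ) :
    Complex.exp (Real.log r - φ * Complex.I) = r * Complex.exp (-φ * Complex.I) := by
  rw [sub_eq_add_neg, Complex.exp_add, ← Complex.ofReal_exp, Real.exp_log hr, neg_mul]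

lemma norm_raySol_sub_le {β : ℝ} (hβ : 0 ≤ β) (η : ℂ) (φ : ℝ) {r : ℝ} (hr : 0 < r)
    (hr1 : r ≤ 1) :
    ‖raySol β η φ r - r * Complex.exp (-φ * Complex.I)‖ ≤ Real.exp (1 + ‖η‖) * r ^ 3 := by
  have h := norm_logSol_sub_exp_le hβ η (w := Real.log r - φ * Complex.I)
    (by rw [re_log_sub]; exact Real.log_nonpos hr.le hr1)
  rw [exp_log_sub hr, re_log_sub, mul_comm 3 (Real.log r), Real.exp_mul, Real.exp_log hr,
    Real.rpow_ofNat] at h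
  rwa [raySol, if_pos hr]

lemma norm_raySolDeriv_sub_le {β : ℝ} (hβ : 0 ≤ β) (η : ℂ) (φ : ℝ) {r : ℝ} (hr : 0 < r)
    (hr1 : r ≤ 1) :
    ‖raySolDeriv β η φ r - Complex.exp (-φ * Complex.I)‖ ≤ Real.exp (1 + ‖η‖) * r ^ 2 := by
  have h := norm_logSolDeriv_sub_exp_le hβ η (w := Real.log r - φ * Complex.I)
    (by rw [re_log_sub]; exact Real.log_nonpos hr.le hr1)
  rw [exp_log_sub hr, re_log_sub, mul_comm 3 (Real.log r), Real.exp_mul, Real.exp_log hr,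
    Real.rpow_ofNat] at h
  have hr' : (r : ℂ) ≠ 0 := Complex.ofReal_ne_zero.2 hr.ne'
  have e : raySolDeriv β η φ r - Complex.exp (-φ * Complex.I) =
      (logSolDeriv β η (Real.log r - φ * Complex.I) - r * Complex.exp (-φ * Complex.I)) / r := by
    simp only [raySolDeriv, hr, if_true]
    field_simp
  rw [e, norm_div, Complex.norm_real, Real.norm_of_nonneg hr.le, div_le_iff₀ hr]
  exact h.trans_eq (by ring)

lemma hasDerivWithinAt_raySol {β : ℝ} (hβ : 0 ≤ β) (η : ℂ) (φ : ℝ) {r : ℝ} (hr : 0 ≤ r) :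
    HasDerivWithinAt (raySol β η φ) (raySolDeriv β η φ r) (Ici 0) r := by
  rcases hr.eq_or_lt with rfl | hr
  · rw [hasDerivWithinAt_iff_isLittleO]
    have h0 : raySol β η φ 0 = 0 := by simp [raySol]
    have h1 : raySolDeriv β η φ 0 = Complex.exp (-φ * Complex.I) := by simp [raySolDeriv]
    rw [h0, h1]
    have hO : (fun r : ℝ => raySol β η φ r - 0 - (r - 0) • Complex.exp (-φ * Complex.I))
        =O[𝓝[≥] 0] fun r : ℝ => r ^ 2 := by
      refine Asymptotics.IsBigO.of_bound (Real.exp (1 + ‖η‖)) ?_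
      filter_upwards [self_mem_nhdsWithin, mem_nhdsWithin_of_mem_nhds (Iio_mem_nhds one_pos)]
        with r (hr : 0 ≤ r) (hr1 : r < 1)
      rcases hr.eq_or_lt with rfl | hr
      · simp [raySol]
      · have h := norm_raySol_sub_le hβ η φ hr hr1.le
        rw [sub_zero, sub_zero, Complex.real_smul, Real.norm_of_nonneg (by positivity)]
        refine h.trans ?_
        gcongr ?_ * ?_
        nlinarith [pow_pos hr 2]
    refine hO.trans_isLittleO ?_
    have h2 : (fun r : ℝ => r ^ 2) =o[𝓝 0] fun r : ℝ => r - 0 := by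
      simpa using Asymptotics.isLittleO_pow_pow (𝕜 := ℝ) (one_lt_two)
    exact h2.mono nhdsWithin_le_nhds
  · exact ((isSchrodingerSol_raySol hβ η φ).hasDerivAt r hr).hasDerivWithinAt

lemma continuousOn_raySolDeriv {β : ℝ} (hβ : 0 ≤ β) (η : ℂ) (φ : ℝ) :
    ContinuousOn (raySolDeriv β η φ) (Ici 0) := by
  intro r (hr : 0 ≤ r)
  rcases hr.eq_or_lt with rfl | hr
  · have h1 : raySolDeriv β η φ 0 = Complex.exp (-φ * Complex.I) := by simp [raySolDeriv]
    rw [ContinuousWithinAt, h1, tendsto_iff_norm_sub_tendsto_zero]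
    have h2 : Tendsto (fun r : ℝ => Real.exp (1 + ‖η‖) * r ^ 2) (𝓝[≥] 0) (𝓝 0) := by
      have : Continuous fun r : ℝ => Real.exp (1 + ‖η‖) * r ^ 2 := by fun_prop
      simpa using (this.tendsto 0).mono_left nhdsWithin_le_nhds
    refine squeeze_zero' (Eventually.of_forall fun _ => norm_nonneg _) ?_ h2
    filter_upwards [self_mem_nhdsWithin, mem_nhdsWithin_of_mem_nhds (Iio_mem_nhds one_pos)]
      with r (hr : 0 ≤ r) (hr1 : r < 1)
    rcases hr.eq_or_lt with rfl | hr
    · simp [raySolDeriv]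
    · exact norm_raySolDeriv_sub_le hβ η φ hr hr1.le
  · exact ((isSchrodingerSol_raySol hβ η φ).hasDerivAt_deriv r hr).continuousAt.continuousWithinAt

lemma logSol_eq_raySol (β : ℝ) (η w : ℂ) :
    logSol β η w = raySol β η (-w.im) (Real.exp w.re) := by
  rw [raySol, if_pos (Real.exp_pos _), Real.log_exp]
  congr 1
  apply Complex.ext <;> simp

lemma norm_mul_exp_neg_two_mul_I (η : ℂ) (φ : ℝ) :
    ‖η * Complex.exp (-(2 * φ) * Complex.I)‖ = ‖η‖ := by
  have : (-(2 * φ) : ℂ) = ((-(2 * φ) : ℝ) : ℂ) := by push_cast; ring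
  rw [norm_mul, this, Complex.norm_exp_ofReal_mul_I, mul_one]

/-- The solution has growth order at most `β / 2 + 1`, uniformly in the argument. -/
lemma exists_norm_logSol_le {β : ℝ} (hβ : 0 ≤ β) (η : ℂ) :
    ∃ C K, 0 < K ∧ ∀ w, ‖logSol β η w‖ ≤ C * Real.exp (K * Real.exp ((β / 2 + 1) * w.re)) := by
  set B := 1 + Real.exp (1 + ‖η‖) with hB
  have hB0 : 0 < B := by positivity
  refine ⟨2 * B, β + 2 + ‖η‖, by positivity, fun w => ?_⟩
  set K := β + 2 + ‖η‖ with hK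
  have hK0 : 0 ≤ K := by positivity
  rcases le_total w.re 0 with hw | hw
  · have h1 := norm_logSol_sub_exp_le hβ η hw
    have h2 : ‖logSol β η w‖ ≤ ‖Complex.exp w‖ + ‖logSol β η w - Complex.exp w‖ := by
      simpa using norm_add_le (Complex.exp w) (logSol β η w - Complex.exp w)
    rw [Complex.norm_exp] at h2
    have h3 : Real.exp w.re ≤ 1 := Real.exp_le_one_iff.2 hw
    have h4 : Real.exp (3 * w.re) ≤ 1 := Real.exp_le_one_iff.2 (by linarith)
    have h5 : 1 ≤ Real.exp (K * Real.exp ((β / 2 + 1) * w.re)) :=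
      Real.one_le_exp (by positivity)
    have h6 := Real.exp_pos (1 + ‖η‖)
    nlinarith
  · have h1 := (isSchrodingerSol_raySol hβ η (-w.im)).norm_sq_le_exp hβ (norm_rayPhase _ _)
      (Real.one_le_exp hw)
    have h2 := norm_raySol_sub_le hβ η (-w.im) one_pos le_rfl
    have h3 := norm_raySolDeriv_sub_le hβ η (-w.im) one_pos le_rfl
    have hn : ‖Complex.exp (-(-w.im : ℝ) * Complex.I)‖ = 1 := by
      rw [← Complex.ofReal_neg]; exact Complex.norm_exp_ofReal_mul_I _
    have h4 : ‖raySol β η (-w.im) 1‖ ≤ B := by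
      have := norm_sub_norm_le (raySol β η (-w.im) 1)
        ((1 : ℝ) * Complex.exp (-(-w.im : ℝ) * Complex.I))
      rw [norm_mul, hn] at this
      simp only [Complex.ofReal_one, norm_one, one_pow] at this h2 ⊢
      linarith
    have h5 : ‖raySolDeriv β η (-w.im) 1‖ ≤ B := by
      have := norm_sub_norm_le (raySolDeriv β η (-w.im) 1)
        (Complex.exp (-(-w.im : ℝ) * Complex.I))
      rw [hn] at this
      simp only [one_pow] at h3
      linarith
    rw [← logSol_eq_raySol, norm_mul_exp_neg_two_mul_I, ← Real.exp_mul, mul_comm w.re] at h1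
    set e := Real.exp ((β / 2 + 1) * w.re)
    refine abs_le_of_sq_le_sq' ?_ (by positivity) |>.2
    refine h1.trans ?_
    rw [mul_pow, ← Real.exp_nat_mul]
    refine mul_le_mul ?_ (Real.exp_le_exp.2 ?_) (Real.exp_pos _).le (by positivity)
    · nlinarith [norm_nonneg (raySol β η (-w.im) 1), norm_nonneg (raySolDeriv β η (-w.im) 1)]
    · have : 0 ≤ K * e := by positivity
      push_cast; linarith

lemma energy_raySol_nonpos_of_norm_le {β X φ C d : ℝ} {η : ℂ} (hβ : 0 ≤ β) (hX1 : 1 ≤ X)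
    (hX : 4 * ‖η‖ ≤ X ^ β) (hφ0 : 0 ≤ φ) (hφ : φ ≤ Real.pi / (2 * (β + 2))) (hd : 0 < d)
    (h : ∀ w : ℂ, w.im = -φ → ‖logSol β η w‖ ≤ C * Real.exp (-d * Real.exp ((β / 2 + 1) * w.re)))
    {r : ℝ} (hr : X ≤ r) :
    energy (1 - Complex.I) (raySol β η φ) (raySolDeriv β η φ) r ≤ 0 := by
  refine (isSchrodingerSol_raySol hβ η φ).energy_nonpos_of_norm_le_exp hβ (norm_rayPhase β φ)
    (one_le_rayPhase hβ hφ0 hφ) hX1 (by rwa [norm_mul_exp_neg_two_mul_I]) hd (C := C) ?_ hr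
  intro t ht
  have ht0 : 0 < t := by linarith
  have h1 := h (Real.log t - φ * Complex.I) (by simp)
  rw [re_log_sub, mul_comm (β / 2 + 1), ← Real.rpow_def_of_pos ht0] at h1
  rwa [raySol, if_pos ht0]

lemma exists_norm_logSol_le_of_energy_nonpos {β X φ : ℝ} {η : ℂ} (hβ : 0 ≤ β) (hX1 : 1 ≤ X)
    (hX : 4 * ‖η‖ ≤ X ^ β) (hφ0 : 0 ≤ φ) (hφ : φ ≤ Real.pi / (2 * (β + 2)))
    (hE : ∀ r, X ≤ r → energy (1 - Complex.I) (raySol β η φ) (raySolDeriv β η φ) r ≤ 0) :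
    ∃ C, ∀ w : ℂ, w.im = -φ → ‖logSol β η w‖ ≤
      C * Real.exp (-(1 / (2 * (β + 2))) * Real.exp ((β / 2 + 1) * w.re)) := by
  obtain ⟨C, hC⟩ := (isSchrodingerSol_raySol hβ η φ).norm_le_exp hβ (one_le_rayPhase hβ hφ0 hφ)
    hX1 (by rwa [norm_mul_exp_neg_two_mul_I]) hE
  obtain ⟨C₀, K, hK, hgrow⟩ := exists_norm_logSol_le hβ η
  set δ := 1 / (2 * (β + 2)) with hδ
  have hδ0 : 0 < δ := by positivity
  have hC₀ : 0 ≤ C₀ :=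
    nonneg_of_mul_nonneg_left ((norm_nonneg _).trans (hgrow 0)) (Real.exp_pos _)
  refine ⟨max C (C₀ * Real.exp ((K + δ) * X ^ (β / 2 + 1))), fun w hw => ?_⟩
  have he : Real.exp ((β / 2 + 1) * w.re) = Real.exp w.re ^ (β / 2 + 1) := by
    rw [← Real.exp_mul, mul_comm]
  rcases le_total X (Real.exp w.re) with hwX | hwX
  · have h1 := hC _ hwX
    rw [logSol_eq_raySol, hw, neg_neg, he]
    refine h1.trans ?_
    gcongr
    exact le_max_left _ _
  · have h2 : Real.exp w.re ^ (β / 2 + 1) ≤ X ^ (β / 2 + 1) := by gcongr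
    refine le_trans (hgrow w) ?_
    rw [he]
    calc C₀ * Real.exp (K * Real.exp w.re ^ (β / 2 + 1))
        ≤ C₀ * Real.exp ((K + δ) * X ^ (β / 2 + 1) + -δ * Real.exp w.re ^ (β / 2 + 1)) := by
          gcongr
          nlinarith
      _ = C₀ * Real.exp ((K + δ) * X ^ (β / 2 + 1)) *
          Real.exp (-δ * Real.exp w.re ^ (β / 2 + 1)) := by rw [Real.exp_add, mul_assoc]
      _ ≤ _ := by
          gcongr
          exact le_max_right _ _

/-- Nonpositivity of the energy propagates from the positive ray to the other rays. -/
lemma energy_raySol_nonpos {β X φ : ℝ} {η : ℂ} (hβ : 0 ≤ β) (hX1 : 1 ≤ X)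
    (hX : 4 * ‖η‖ ≤ X ^ β) (hφ0 : 0 ≤ φ) (hφ : φ ≤ Real.pi / (2 * (β + 2)))
    (h : ∀ r, X ≤ r → energy (1 - Complex.I) (raySol β η 0) (raySolDeriv β η 0) r ≤ 0)
    {r : ℝ} (hr : X ≤ r) :
    energy (1 - Complex.I) (raySol β η φ) (raySolDeriv β η φ) r ≤ 0 := by
  obtain ⟨C₀, K, hK, hgrow⟩ := exists_norm_logSol_le hβ η
  have hp : 0 < β / 2 + 1 := by positivity
  have hδ : 0 < 1 / (2 * (β + 2)) := by positivity
  set p := β / 2 + 1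
  set δ := 1 / (2 * (β + 2))
  have hs₀ : 0 < min (1 / p) (δ / 4 / (K * p)) := by positivity
  obtain ⟨N, hN⟩ := exists_nat_gt (φ / min (1 / p) (δ / 4 / (K * p)))
  have hN0 : (0 : ℝ) < N := (div_nonneg hφ0 hs₀.le).trans_lt hN
  set s := φ / N with hs
  have hss₀ : s ≤ min (1 / p) (δ / 4 / (K * p)) := by
    rw [div_lt_iff₀ hs₀] at hN
    rw [hs, div_le_iff₀ hN0]
    linarith
  have hs1 : p * s ≤ 1 := by
    have := hss₀.trans (min_le_left _ _)
    rwa [le_div_iff₀ hp, mul_comm] at this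
  have hs2 : K * (p * s) ≤ δ / 4 := by
    have := hss₀.trans (min_le_right _ _)
    rwa [le_div_iff₀ (by positivity), mul_comm, mul_assoc] at this
  have hs0 : 0 ≤ s := by positivity
  have hsN : N * s = φ := by rw [hs]; field_simp
  have key : ∀ n : ℕ, n ≤ N → ∀ r, X ≤ r →
      energy (1 - Complex.I) (raySol β η (n * s)) (raySolDeriv β η (n * s)) r ≤ 0 := by
    intro n
    induction n with
    | zero => simpa using h
    | succ n ih =>
      intro hn r hr
      have hle : ∀ m : ℕ, m ≤ N → m * s ≤ Real.pi / (2 * (β + 2)) := fun m hm => by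
        refine le_trans ?_ hφ
        rw [← hsN]
        gcongr
      obtain ⟨C, hC⟩ := exists_norm_logSol_le_of_energy_nonpos hβ hX1 hX (by positivity)
        (hle n (by omega)) (ih (by omega))
      obtain ⟨C', hC'⟩ := exists_norm_le_exp_neg_of_line
        (fun w => (hasDerivAt_logSol hβ η w).differentiableAt) hp hδ hK hgrow hC hs0 hs1 hs2
      refine energy_raySol_nonpos_of_norm_le hβ hX1 hX (by positivity) (hle _ hn)
        (by positivity : 0 < δ / 4) (C := C') (fun w hw => hC' w ?_) hr
      rw [hw]
      push_cast
      ring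
  have := key N le_rfl r hr
  rwa [hsN] at this

/-- A solution of `G'' = Q G` with locally bounded `Q` and vanishing initial data vanishes. -/
lemma eq_zero_of_initial_eq_zero {Q D D₁ : ℝ → ℂ}
    (hD : ∀ r ∈ Ici (0 : ℝ), HasDerivWithinAt D (D₁ r) (Ici 0) r)
    (hD₁c : ContinuousOn D₁ (Ici 0)) (hD₁ : ∀ r, 0 < r → HasDerivAt D₁ (Q r * D r) r)
    (hQ : ContinuousOn Q (Ici 0)) (h0 : D 0 = 0) (h1 : D₁ 0 = 0) {r : ℝ} (hr : 0 ≤ r) :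
    D r = 0 := by
  obtain ⟨M, hM⟩ := (isCompact_Icc (a := (0 : ℝ)) (b := r)).exists_bound_of_continuousOn
    (hQ.mono Icc_subset_Ici_self)
  have hM0 : 0 ≤ M := (norm_nonneg _).trans (hM 0 ⟨le_rfl, hr⟩)
  have hDc : ContinuousOn D (Ici 0) := fun t ht => (hD t ht).continuousWithinAt
  have hsol : IsSchrodingerSol Q D D₁ :=
    ⟨fun t ht => (hD t (ht.le : (0 : ℝ) ≤ t)).hasDerivAt (Ici_mem_nhds ht), hD₁⟩
  have hanti : AntitoneOn (fun t => (‖D t‖ ^ 2 + ‖D₁ t‖ ^ 2) * Real.exp (-(1 + M) * t))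
      (Icc 0 r) := by
    refine antitoneOn_of_hasDerivWithinAt_nonpos (convex_Icc 0 r)
      (f' := fun t => (2 * (conj (D t) * D₁ t).re + 2 * (conj (D₁ t) * (Q t * D t)).re) *
        Real.exp (-(1 + M) * t) + (‖D t‖ ^ 2 + ‖D₁ t‖ ^ 2) *
        (Real.exp (-(1 + M) * t) * (-(1 + M)))) ?_ ?_ ?_
    · refine ContinuousOn.mul ?_ (by fun_prop)
      exact ((hDc.norm.pow 2).add (hD₁c.norm.pow 2)).mono Icc_subset_Ici_self
    · intro t ht
      rw [interior_Icc] at ht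
      have he : HasDerivAt (fun t => Real.exp (-(1 + M) * t))
          (Real.exp (-(1 + M) * t) * (-(1 + M))) t := by
        simpa using ((hasDerivAt_id t).const_mul (-(1 + M))).exp
      exact (((hsol.hasDerivAt_norm_sq ht.1).add
        (hsol.hasDerivAt_norm_deriv_sq ht.1)).mul he).hasDerivWithinAt
    · intro t ht
      rw [interior_Icc] at ht
      have a1 : (conj (D t) * D₁ t).re ≤ ‖D t‖ * ‖D₁ t‖ :=
        (Complex.re_le_norm _).trans_eq (by simp)
      have a2 : (conj (D₁ t) * (Q t * D t)).re ≤ ‖D₁ t‖ * (M * ‖D t‖) := by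
        refine (Complex.re_le_norm _).trans ?_
        simp only [norm_mul, RCLike.norm_conj]
        gcongr
        exact hM t ⟨ht.1.le, ht.2.le⟩
      have a3 : 2 * (conj (D t) * D₁ t).re + 2 * (conj (D₁ t) * (Q t * D t)).re ≤
          (1 + M) * (‖D t‖ ^ 2 + ‖D₁ t‖ ^ 2) := by
        nlinarith [mul_nonneg (by linarith : 0 ≤ 1 + M) (sq_nonneg (‖D t‖ - ‖D₁ t‖))]
      have := mul_le_mul_of_nonneg_right a3 (Real.exp_pos (-(1 + M) * t)).le
      linarith
  have h2 := hanti ⟨le_rfl, hr⟩ ⟨hr, le_rfl⟩ hr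
  simp only [h0, h1] at h2
  have h3 : ‖D r‖ ^ 2 + ‖D₁ r‖ ^ 2 ≤ 0 := by
    refine nonpos_of_mul_nonpos_left (h2.trans_eq (by simp)) (Real.exp_pos _)
  have h4 : ‖D r‖ ^ 2 = 0 := le_antisymm (by linarith [sq_nonneg ‖D₁ r‖]) (sq_nonneg _)
  simpa using h4

/-- A solution vanishing at the origin is a multiple of `raySol β η 0`. -/
lemma eq_mul_raySol {β : ℝ} (hβ : 0 ≤ β) {η : ℂ} {F F' F'' : ℝ → ℂ}
    (hF1 : ∀ x ∈ Ici (0:ℝ), HasDerivWithinAt F (F' x) (Ici 0) x)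
    (hF2 : ∀ x ∈ Ici (0:ℝ), HasDerivWithinAt F' (F'' x) (Ici 0) x)
    (hode : ∀ x : ℝ, 0 ≤ x → F'' x = rayPotential β Complex.I η x * F x) (hF0 : F 0 = 0)
    {r : ℝ} (hr : 0 ≤ r) : F r = F' 0 * raySol β η 0 r := by
  have hsol := isSchrodingerSol_raySol hβ η 0
  have hphase : rayPhase β 0 = Complex.I := by
    rw [rayPhase, mul_zero, sub_zero, Complex.exp_mul_I, ← Complex.ofReal_cos,
      ← Complex.ofReal_sin]
    simp
  rw [hphase, Complex.ofReal_zero, mul_zero, neg_zero, zero_mul, Complex.exp_zero, mul_one] at hsol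
  refine sub_eq_zero.1 (eq_zero_of_initial_eq_zero (Q := rayPotential β Complex.I η)
    (D := fun r => F r - F' 0 * raySol β η 0 r)
    (D₁ := fun r => F' r - F' 0 * raySolDeriv β η 0 r)
    (fun t ht => (hF1 t ht).sub ((hasDerivWithinAt_raySol hβ η 0 ht).const_mul _))
    (ContinuousOn.sub (fun t ht => (hF2 t ht).continuousWithinAt)
      (continuousOn_const.mul (continuousOn_raySolDeriv hβ η 0)))
    (fun t ht => ?_) ?_ (by simp [raySol, hF0]) (by simp [raySolDeriv]) hr)
  · refine (((hF2 t (ht.le : (0 : ℝ) ≤ t)).hasDerivAt (Ici_mem_nhds ht)).sub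
      ((hsol.hasDerivAt_deriv t ht).const_mul (F' 0))).congr_deriv ?_
    rw [hode t ht.le]
    ring
  · unfold rayPotential
    have : Continuous fun r : ℝ => r ^ β := Real.continuous_rpow_const hβ
    fun_prop

namespace IsSchrodingerSol

/-- The integrated energy identity for solutions vanishing at the origin. -/
lemma integral_energy_deriv_eq_zero {Q G G₁ : ℝ → ℂ} (h : IsSchrodingerSol Q G G₁) (κ : ℂ)
    (hGc : ContinuousOn G (Ici 0)) (hG₁c : ContinuousOn G₁ (Ici 0)) (h0 : G 0 = 0)
    (hG : IntegrableOn (fun r => ‖G r‖ ^ 2) (Ioi 0))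
    (hG₁ : IntegrableOn (fun r => ‖G₁ r‖ ^ 2) (Ioi 0))
    (hInt : IntegrableOn (fun r => κ.re * ‖G₁ r‖ ^ 2 + (κ * Q r).re * ‖G r‖ ^ 2) (Ioi 0)) :
    ∫ r in Ioi 0, (κ.re * ‖G₁ r‖ ^ 2 + (κ * Q r).re * ‖G r‖ ^ 2) = 0 := by
  have hEc : ContinuousOn (energy κ G G₁) (Ici 0) :=
    Complex.continuous_re.comp_continuousOn (continuousOn_const.mul
      ((Complex.continuous_conj.comp_continuousOn hGc).mul hG₁c))
  have hEint : IntegrableOn (energy κ G G₁) (Ioi 0) := by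
    refine ((hG.add hG₁).const_mul ‖κ‖).mono'
      ((hEc.mono Ioi_subset_Ici_self).aestronglyMeasurable measurableSet_Ioi)
      (ae_of_all _ fun r => (abs_energy_le κ G G₁ r).trans ?_)
    simp only [Pi.add_apply]
    gcongr
    nlinarith [sq_nonneg (‖G r‖ - ‖G₁ r‖), sq_nonneg ‖G r‖, sq_nonneg ‖G₁ r‖]
  have hd : ∀ r ∈ Ioi (0 : ℝ), HasDerivAt (energy κ G G₁)
      (κ.re * ‖G₁ r‖ ^ 2 + (κ * Q r).re * ‖G r‖ ^ 2) r := fun r hr => h.hasDerivAt_energy κ hr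
  rw [integral_Ioi_of_hasDerivAt_of_tendsto (hEc 0 self_mem_Ici) hd hInt
    (tendsto_zero_of_hasDerivAt_of_integrableOn_Ioi hd hInt hEint)]
  simp [energy, h0]

/-- A solution with nonpositive energy has finite form norm. -/
lemma integrableOn_of_energy_nonpos {β X : ℝ} {ω μ : ℂ} {G G₁ : ℝ → ℂ}
    (h : IsSchrodingerSol (rayPotential β ω μ) G G₁) (hβ : 0 ≤ β)
    (hω : 1 ≤ ω.re + ω.im) (hX1 : 1 ≤ X) (hX : 4 * ‖μ‖ ≤ X ^ β)
    (hE : ∀ r, X ≤ r → energy (1 - Complex.I) G G₁ r ≤ 0)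
    (hGc : ContinuousOn G (Ici 0)) (hG₁c : ContinuousOn G₁ (Ici 0)) :
    IntegrableOn (fun r => ‖G r‖ ^ 2) (Ioi 0) ∧ IntegrableOn (fun r => ‖G₁ r‖ ^ 2) (Ioi 0) ∧
      IntegrableOn (fun r => r ^ β * ‖G r‖ ^ 2) (Ioi 0) := by
  have hX0 : 0 ≤ X := by linarith
  have hInt := integrableOn_Ioi_deriv_of_nonneg' (a := X)
    (fun r (hr : X ≤ r) => h.hasDerivAt_energy (1 - Complex.I) (by linarith))
    (fun r (hr : X < r) => by
      have : 0 < r := by linarith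
      exact le_trans (by positivity) (energy_deriv_ge hβ hω hX1 hX hr.le))
    (h.tendsto_energy hβ hω hX1 hX hE)
  have key : ∀ f : ℝ → ℝ, ContinuousOn f (Ici 0) →
      (∀ r, X ≤ r → |f r| ≤ 2 * (‖G₁ r‖ ^ 2 + r ^ β / 2 * ‖G r‖ ^ 2)) →
      IntegrableOn f (Ioi 0) := by
    intro f hf hle
    rw [← Ioc_union_Ioi_eq_Ioi hX0]
    refine IntegrableOn.union
      ((hf.mono Icc_subset_Ici_self).integrableOn_Icc.mono_set Ioc_subset_Icc_self) ?_
    refine (hInt.const_mul 2).mono'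
      ((hf.mono ((Ioi_subset_Ioi hX0).trans Ioi_subset_Ici_self)).aestronglyMeasurable
        measurableSet_Ioi) ?_
    refine (ae_restrict_iff' measurableSet_Ioi).2 (ae_of_all _ fun r (hr : X < r) => ?_)
    exact (hle r hr.le).trans
      (mul_le_mul_of_nonneg_left (energy_deriv_ge hβ hω hX1 hX hr.le) zero_le_two)
  refine ⟨key _ (hGc.norm.pow 2) fun r hr => ?_, key _ (hG₁c.norm.pow 2) fun r hr => ?_,
    key _ ((Real.continuous_rpow_const hβ).continuousOn.mul (hGc.norm.pow 2)) fun r hr => ?_⟩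
  · rw [abs_of_nonneg (by positivity)]
    have : 1 ≤ r ^ β := Real.one_le_rpow (by linarith) hβ
    nlinarith [sq_nonneg ‖G r‖, sq_nonneg ‖G₁ r‖]
  · have : 0 ≤ r := by linarith
    rw [abs_of_nonneg (by positivity)]
    have : 0 ≤ r ^ β / 2 * ‖G r‖ ^ 2 := by positivity
    linarith [sq_nonneg ‖G₁ r‖]
  · have : 0 ≤ r := by linarith
    rw [abs_of_nonneg (by positivity)]
    linarith [sq_nonneg ‖G₁ r‖]

end IsSchrodingerSol

lemma eq_zero_of_integral_norm_sq_eq_zero {G : ℝ → ℂ} (hGc : ContinuousOn G (Ioi 0))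
    (hG : IntegrableOn (fun r => ‖G r‖ ^ 2) (Ioi 0)) (h : ∫ r in Ioi 0, ‖G r‖ ^ 2 = 0) :
    ∀ r, 0 < r → G r = 0 := by
  rw [setIntegral_eq_zero_iff_of_nonneg_ae (ae_of_all _ fun _ => sq_nonneg _) hG] at h
  have h1 : G =ᵐ[volume.restrict (Ioi 0)] fun _ => 0 := by
    filter_upwards [h] with r hr
    simpa using hr
  exact fun r hr => Measure.eqOn_open_of_ae_eq h1 isOpen_Ioi hGc continuousOn_const hr

lemma mul_integral_le_of_lintegral_le {α : Type*} [MeasurableSpace α] {μ : Measure α} {c : ℝ}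
    (hc : 0 ≤ c) {f g h : α → ℝ} (hf : Integrable f μ) (hg : Integrable g μ) (hh : Integrable h μ)
    (hf0 : 0 ≤ᵐ[μ] f) (hg0 : 0 ≤ᵐ[μ] g) (hh0 : 0 ≤ᵐ[μ] h)
    (hle : ENNReal.ofReal c * ∫⁻ x, ENNReal.ofReal (f x) ∂μ ≤
      (∫⁻ x, ENNReal.ofReal (g x) ∂μ) + ∫⁻ x, ENNReal.ofReal (h x) ∂μ) :
    c * ∫ x, f x ∂μ ≤ (∫ x, g x ∂μ) + ∫ x, h x ∂μ := by
  have hg1 := integral_nonneg_of_ae hg0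
  have hh1 := integral_nonneg_of_ae hh0
  rw [← ofReal_integral_eq_lintegral_ofReal hf hf0, ← ofReal_integral_eq_lintegral_ofReal hg hg0,
    ← ofReal_integral_eq_lintegral_ofReal hh hh0, ← ENNReal.ofReal_mul hc,
    ← ENNReal.ofReal_add hg1 hh1] at hle
  exact (ENNReal.ofReal_le_ofReal_iff (by positivity)).1 hle

/-- `c` is a lower bound of the form `∫ |u'|² + ∫ x ^ β |u|²`, among the `u` of finite form norm. -/
def IsFormLowerBound (β c : ℝ) : Prop :=
  ∀ u u' : ℝ → ℂ, (∀ x ∈ Ici (0:ℝ), HasDerivWithinAt u (u' x) (Ici 0) x) →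
    ContinuousOn u' (Ici 0) →
    IntegrableOn (fun x => ‖u x‖ ^ 2) (Ioi 0) → IntegrableOn (fun x => ‖u' x‖ ^ 2) (Ioi 0) →
    IntegrableOn (fun x => x ^ β * ‖u x‖ ^ 2) (Ioi 0) →
    c * ∫ x in Ioi 0, ‖u x‖ ^ 2 ≤ (∫ x in Ioi 0, ‖u' x‖ ^ 2) + ∫ x in Ioi 0, x ^ β * ‖u x‖ ^ 2

namespace IsFormLowerBound

lemma le_one {c : ℝ} (hc : IsFormLowerBound 0 c) : c ≤ 1 := by
  by_contra! h1
  obtain ⟨ε, hε, hεc⟩ : ∃ ε : ℝ, 0 < ε ∧ ε ^ 2 + 1 < c :=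
    ⟨√((c - 1) / 2), Real.sqrt_pos.2 (by linarith), by
      rw [Real.sq_sqrt (by linarith)]; linarith⟩
  have hn : ∀ x : ℝ, ‖((Real.exp (-ε * x) : ℝ) : ℂ)‖ ^ 2 = Real.exp (-(2 * ε) * x) := fun x => by
    rw [Complex.norm_real, Real.norm_of_nonneg (Real.exp_pos _).le, ← Real.exp_nat_mul]
    congr 1
    push_cast
    ring
  have hn' : ∀ x : ℝ, ‖((-ε : ℝ) : ℂ) * ((Real.exp (-ε * x) : ℝ) : ℂ)‖ ^ 2 =
      ε ^ 2 * Real.exp (-(2 * ε) * x) := fun x => by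
    rw [norm_mul, mul_pow, hn, Complex.norm_real, norm_neg, Real.norm_eq_abs, sq_abs]
  have hInt : IntegrableOn (fun x => Real.exp (-(2 * ε) * x)) (Ioi 0) :=
    exp_neg_integrableOn_Ioi 0 (by positivity)
  have h := hc (fun x => (Real.exp (-ε * x) : ℝ)) (fun x => (-ε : ℝ) * (Real.exp (-ε * x) : ℝ))
    (fun x _ => by
      have : HasDerivAt (fun x => Real.exp (-ε * x)) (-ε * Real.exp (-ε * x)) x := by
        simpa [mul_comm] using ((hasDerivAt_id x).const_mul (-ε)).exp
      have := this.ofReal_comp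
      rw [Complex.ofReal_mul] at this
      exact this.hasDerivWithinAt)
    (by fun_prop) (by simpa only [hn] using hInt) (by simp only [hn']; exact hInt.const_mul _)
    (by simpa only [hn, Real.rpow_zero, one_mul] using hInt)
  simp only [hn, hn', Real.rpow_zero, one_mul] at h
  rw [integral_const_mul, integral_exp_mul_Ioi (by linarith)] at h
  have h2 : 0 < -Real.exp (-(2 * ε) * 0) / (-(2 * ε)) := by
    rw [neg_div_neg_eq]
    positivity
  nlinarith

/-- On the ray on which the potential is real, a nonzero solution vanishing at the origin cannot
have nonpositive energy. -/
lemma exists_energy_raySol_pos {β c X : ℝ} {η : ℂ} (hβ : 0 ≤ β) (hc : IsFormLowerBound β c)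
    (hη : ‖η‖ < c) (hX1 : 1 ≤ X) (hX : 4 * ‖η‖ ≤ X ^ β) :
    ∃ r, X ≤ r ∧ 0 < energy (1 - Complex.I) (raySol β η (Real.pi / (2 * (β + 2))))
      (raySolDeriv β η (Real.pi / (2 * (β + 2)))) r := by
  by_contra! hE
  set φ := Real.pi / (2 * (β + 2)) with hφ
  have hphase : rayPhase β φ = 1 := by
    have : Real.pi / 2 - (β + 2) * φ = 0 := by rw [hφ]; field_simp; ring
    rw [rayPhase, this, Complex.ofReal_zero, zero_mul, Complex.exp_zero]
  have hsol := isSchrodingerSol_raySol hβ η φ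
  have hμ := norm_mul_exp_neg_two_mul_I η φ
  rw [hphase] at hsol
  set μ := η * Complex.exp (-(2 * φ) * Complex.I)
  set G := raySol β η φ
  set G₁ := raySolDeriv β η φ
  have hGd : ∀ r ∈ Ici (0 : ℝ), HasDerivWithinAt G (G₁ r) (Ici 0) r :=
    fun r hr => hasDerivWithinAt_raySol hβ η φ hr
  have hGc : ContinuousOn G (Ici 0) := fun r hr => (hGd r hr).continuousWithinAt
  have hG₁c : ContinuousOn G₁ (Ici 0) := continuousOn_raySolDeriv hβ η φ
  have hG0 : G 0 = 0 := by simp [G, raySol]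
  obtain ⟨h1, h2, h3⟩ := hsol.integrableOn_of_energy_nonpos hβ (by simp) hX1 (by rwa [hμ]) hE
    hGc hG₁c
  have e : ∀ r, (1 : ℂ).re * ‖G₁ r‖ ^ 2 + (1 * rayPotential β 1 μ r).re * ‖G r‖ ^ 2 =
      ‖G₁ r‖ ^ 2 + r ^ β * ‖G r‖ ^ 2 - μ.re * ‖G r‖ ^ 2 := fun r => by
    simp only [rayPotential, one_mul, Complex.one_re, Complex.sub_re, Complex.ofReal_re]
    ring
  have h23 : IntegrableOn (fun r => ‖G₁ r‖ ^ 2 + r ^ β * ‖G r‖ ^ 2) (Ioi 0) := h2.add h3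
  have h4 := hsol.integral_energy_deriv_eq_zero 1 hGc hG₁c hG0 h1 h2
    (by simp only [e]; exact h23.sub (h1.const_mul μ.re))
  simp only [e] at h4
  rw [integral_sub h23 (h1.const_mul μ.re), integral_add h2 h3, integral_const_mul] at h4
  have h5 := hc G G₁ hGd hG₁c h1 h2 h3
  have h6 : 0 ≤ ∫ r in Ioi 0, ‖G r‖ ^ 2 := integral_nonneg fun _ => sq_nonneg _
  have h7 : μ.re ≤ ‖η‖ := (Complex.re_le_norm μ).trans_eq hμ
  have h8 : ∫ r in Ioi 0, ‖G r‖ ^ 2 = 0 := by nlinarith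
  have h9 := eq_zero_of_integral_norm_sq_eq_zero (hGc.mono Ioi_subset_Ici_self) h1 h8
  have h10 : HasDerivWithinAt G 0 (Ici 0) 0 := by
    refine (hasDerivWithinAt_const 0 (Ici 0) (0 : ℂ)).congr (fun r (hr : 0 ≤ r) => ?_) hG0
    rcases hr.eq_or_lt with rfl | hr
    exacts [hG0, h9 r hr]
  have h11 := (uniqueDiffOn_Ici (0 : ℝ) 0 self_mem_Ici).eq_deriv _ (hGd 0 self_mem_Ici) h10
  simp [G₁, raySolDeriv] at h11

end IsFormLowerBound

/-- Vanishing for the constant potential. -/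
lemma eq_zero_of_exponent_zero {η : ℂ} (hη : η.im < 1) {F F' : ℝ → ℂ}
    (h : IsSchrodingerSol (rayPotential 0 Complex.I η) F F') (hFc : ContinuousOn F (Ici 0))
    (hF'c : ContinuousOn F' (Ici 0)) (hF : IntegrableOn (fun x => ‖F x‖ ^ 2) (Ioi 0))
    (hF' : IntegrableOn (fun x => ‖F' x‖ ^ 2) (Ioi 0)) (hF0 : F 0 = 0) :
    ∀ r, 0 < r → F r = 0 := by
  have e : ∀ r, (-Complex.I).re * ‖F' r‖ ^ 2 +
      (-Complex.I * rayPotential 0 Complex.I η r).re * ‖F r‖ ^ 2 = (1 - η.im) * ‖F r‖ ^ 2 :=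
    fun r => by simp [rayPotential]
  have h1 := h.integral_energy_deriv_eq_zero (-Complex.I) hFc hF'c hF0 hF hF'
    (by simp only [e]; exact hF.const_mul _)
  simp only [e, integral_const_mul] at h1
  exact eq_zero_of_integral_norm_sq_eq_zero (hFc.mono Ioi_subset_Ici_self) hF
    ((mul_eq_zero.1 h1).resolve_left (by linarith))

/-- Dirichlet vanishing: a twice continuously differentiable solution of
`-F'' + i x^β F - η F = 0` on `[0,∞)` with `F, F', F''` square-integrable and `F(0) = 0`
is identically zero, provided `|η| < c` where `c > 0` satisfies the spectral inequality. -/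
theorem stmt_3 (β : ℝ) (hβ : 0 ≤ β) (c : ℝ) (hc : 0 < c)
    (hspec : ∀ u u' : ℝ → ℂ,
        (∀ x ∈ Ici (0:ℝ), HasDerivWithinAt u (u' x) (Ici 0) x) →
        ContinuousOn u' (Ici 0) →
        IntegrableOn (fun x => ‖u x‖ ^ 2) (Ioi 0) →
        IntegrableOn (fun x => ‖u' x‖ ^ 2) (Ioi 0) →
        ENNReal.ofReal c * (∫⁻ x in Ioi (0:ℝ), ENNReal.ofReal (‖u x‖ ^ 2)) ≤
          (∫⁻ x in Ioi (0:ℝ), ENNReal.ofReal (‖u' x‖ ^ 2)) +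
            ∫⁻ x in Ioi (0:ℝ), ENNReal.ofReal (x ^ β * ‖u x‖ ^ 2))
    (η : ℂ) (hη : ‖η‖ < c)
    (F F' F'' : ℝ → ℂ)
    (hF1 : ∀ x ∈ Ici (0:ℝ), HasDerivWithinAt F (F' x) (Ici 0) x)
    (hF2 : ∀ x ∈ Ici (0:ℝ), HasDerivWithinAt F' (F'' x) (Ici 0) x)
    (hF2c : ContinuousOn F'' (Ici 0))
    (hFL2 : IntegrableOn (fun x => ‖F x‖ ^ 2) (Ioi 0))
    (hF'L2 : IntegrableOn (fun x => ‖F' x‖ ^ 2) (Ioi 0))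
    (hF''L2 : IntegrableOn (fun x => ‖F'' x‖ ^ 2) (Ioi 0))
    (hN : F 0 = 0)
    (hode : ∀ x : ℝ, 0 ≤ x →
      -F'' x + Complex.I * ((x ^ β : ℝ) : ℂ) * F x - η * F x = 0) :
    ∀ x : ℝ, 0 ≤ x → F x = 0 := by
  have hform : IsFormLowerBound β c := fun u u' h1 h2 h3 h4 h5 =>
    mul_integral_le_of_lintegral_le hc.le h3 h4 h5 (ae_of_all _ fun _ => sq_nonneg _)
      (ae_of_all _ fun _ => sq_nonneg _)
      ((ae_restrict_iff' measurableSet_Ioi).2 (ae_of_all _ fun x (hx : 0 < x) => by positivity))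
      (hspec u u' h1 h2 h3 h4)
  have hode' : ∀ x : ℝ, 0 ≤ x → F'' x = rayPotential β Complex.I η x * F x := fun x hx => by
    rw [rayPotential]
    linear_combination -hode x hx
  have hF'c : ContinuousOn F' (Ici 0) := fun x hx => (hF2 x hx).continuousWithinAt
  rcases hβ.eq_or_lt with rfl | hβ0
  · have hsol : IsSchrodingerSol (rayPotential 0 Complex.I η) F F' := by
      refine ⟨fun r hr => (hF1 r (le_of_lt hr)).hasDerivAt (Ici_mem_nhds hr), fun r hr => ?_⟩
      rw [← hode' r hr.le]
      exact (hF2 r (le_of_lt hr)).hasDerivAt (Ici_mem_nhds hr)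
    intro x hx
    rcases hx.eq_or_lt with rfl | hx
    · exact hN
    · refine eq_zero_of_exponent_zero ?_ hsol (fun x hx => (hF1 x hx).continuousWithinAt) hF'c
        hFL2 hF'L2 hN x hx
      linarith [Complex.im_le_norm η, hform.le_one]
  · have hray : ∀ x : ℝ, 0 ≤ x → F x = F' 0 * raySol β η 0 x :=
      fun x hx => eq_mul_raySol hβ hF1 hF2 hode' hN hx
    rcases eq_or_ne (F' 0) 0 with h0 | h0
    · intro x hx
      rw [hray x hx, h0, zero_mul]
    exfalso
    obtain ⟨X, hX, hX1⟩ : ∃ X : ℝ, 4 * ‖η‖ ≤ X ^ β ∧ 1 ≤ X :=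
      (((tendsto_rpow_atTop hβ0).eventually_ge_atTop (4 * ‖η‖)).and
        (eventually_ge_atTop 1)).exists
    have hsol := isSchrodingerSol_raySol hβ η 0
    have hray' : ∀ x : ℝ, 0 < x → F' x = F' 0 * raySolDeriv β η 0 x := fun x hx => by
      refine (hF1 x hx.le).hasDerivAt (Ici_mem_nhds hx) |>.unique
        (((hsol.hasDerivAt x hx).const_mul (F' 0)).congr_of_eventuallyEq ?_)
      filter_upwards [Ioi_mem_nhds hx] with t ht using hray t (le_of_lt ht)
    have hL2 : ∀ f g : ℝ → ℂ, IntegrableOn (fun x => ‖f x‖ ^ 2) (Ioi 0) →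
        (∀ x, 0 < x → f x = F' 0 * g x) → IntegrableOn (fun x => ‖g x‖ ^ 2) (Ioi 0) := by
      intro f g hf hfg
      refine IntegrableOn.congr_fun (hf.const_mul (‖F' 0‖ ^ 2)⁻¹) (fun x hx => ?_) measurableSet_Ioi
      have : ‖F' 0‖ ≠ 0 := norm_ne_zero_iff.2 h0
      simp only [hfg x hx, norm_mul]
      field_simp
    have hE : ∀ r, X ≤ r →
        energy (1 - Complex.I) (raySol β η 0) (raySolDeriv β η 0) r ≤ 0 := fun r hr =>
      hsol.energy_nonpos_of_integrableOn hβ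
        (one_le_rayPhase hβ le_rfl (by positivity)) hX1 (by rwa [norm_mul_exp_neg_two_mul_I])
        (hL2 F _ hFL2 fun x hx => hray x hx.le) (hL2 F' _ hF'L2 hray') hr
    obtain ⟨r, hr, hpos⟩ := hform.exists_energy_raySol_pos hβ hη hX1 hX
    exact hpos.not_ge (energy_raySol_nonpos hβ hX1 hX (by positivity) le_rfl hE hr)
end

section
/- Let β > 0, a > 0, σ > 0, h > 0, K > 0 and λ ∈ ℂ with Im(λ²) ≤ K h². Suppose v : [0,∞) → ℂ is continuously differentiable with v and v' square-integrable on (0,∞), twice differentiable at every point of (0,a) ∪ (a,∞), satisfies −h² v''(x) + i (x−a)₊^β v(x) − λ² v(x) = 0 for all x ∈ (0,a) ∪ (a,∞), and satisfies v(0) = 0 or v'(0) = 0. Then ∫_{a+σ}^∞ |v(x)|² dx ≤ (K h² / σ^β) · ∫₀^∞ |v(x)|² dx, where (x−a)₊ = max(x−a,0). -/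
open MeasureTheory Set

/-- A function that is integrable on a half-line cannot dominate eventually a function with a
positive limit at infinity. -/
theorem le_zero_of_tendsto_of_integrableOn_Ioi {f g : ℝ → ℝ} {L b : ℝ}
    (hg : IntegrableOn g (Ioi b)) (hf : Filter.Tendsto f Filter.atTop (nhds L))
    (hfg : ∀ᶠ x in Filter.atTop, f x ≤ g x) : L ≤ 0 := by
  by_contra! hL
  obtain ⟨R, hR⟩ := Filter.eventually_atTop.1
    ((hfg.and (hf.eventually (lt_mem_nhds (half_lt_self hL)))).and (Filter.eventually_ge_atTop b))
  have hgR : IntegrableOn g (Ioi R) :=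
    hg.mono_set (Ioi_subset_Ioi (hR R le_rfl).2)
  have hc : IntegrableOn (fun _ : ℝ => L / 2) (Ioi R) := by
    refine Integrable.mono' hgR aestronglyMeasurable_const ?_
    refine (ae_restrict_iff' measurableSet_Ioi).2 (Filter.Eventually.of_forall fun x hx => ?_)
    have := (hR x (le_of_lt hx)).1
    rw [Real.norm_of_nonneg (half_pos hL).le]
    linarith [this.1, this.2]
  rw [integrableOn_const_iff] at hc
  rcases hc with hc | hc
  · exact (half_pos hL).ne' (enorm_eq_zero.1 hc)
  · simp at hc

/-- The flux `Im (v' * conj v)` has derivative `Im (v'' * conj v)`. -/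
theorem hasDerivAt_im_mul_conj {v v' : ℝ → ℂ} {v'' : ℂ} {x : ℝ}
    (h₁ : HasDerivAt v (v' x) x) (h₂ : HasDerivAt v' v'' x) :
    HasDerivAt (fun y => (v' y * (starRingEnd ℂ) (v y)).im)
      (v'' * (starRingEnd ℂ) (v x)).im x := by
  have h := Complex.imCLM.hasFDerivAt.comp_hasDerivAt x (h₂.mul h₁.star)
  have e : Complex.imCLM (v'' * star (v x) + v' x * star (v' x))
      = (v'' * (starRingEnd ℂ) (v x)).im := by
    change (v'' * (starRingEnd ℂ) (v x) + v' x * (starRingEnd ℂ) (v' x)).im = _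
    rw [Complex.add_im, Complex.mul_conj, Complex.ofReal_im, add_zero]
  rw [e] at h
  exact h

/-- If `-h²w + i p z - μ z = 0` with `h`, `p` real then `h² Im (w conj z) = (p - Im μ) |z|²`. -/
theorem sq_mul_im_mul_conj_eq {h p : ℝ} {w z μ : ℂ}
    (hw : -(h : ℂ) ^ 2 * w + Complex.I * (p : ℂ) * z - μ * z = 0) :
    h ^ 2 * (w * (starRingEnd ℂ) z).im = (p - μ.im) * ‖z‖ ^ 2 := by
  have e : ((h ^ 2 : ℝ) : ℂ) * w = (Complex.I * p - μ) * z := by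
    push_cast
    linear_combination -hw
  have e₁ := congrArg Complex.re e
  have e₂ := congrArg Complex.im e
  rw [Complex.sq_norm, Complex.normSq_apply]
  simp only [Complex.mul_re, Complex.mul_im, Complex.sub_re, Complex.sub_im, Complex.ofReal_re,
    Complex.ofReal_im, Complex.I_re, Complex.I_im, Complex.conj_re, Complex.conj_im] at e₁ e₂ ⊢
  linear_combination z.re * e₂ - z.im * e₁

/-- Concentration away from the damping: if `Im(λ²) ≤ K h²`, then a solution of
`-h²v'' + i(x-a)₊^β v - λ²v = 0` on `(0,∞)` with `v(0) = 0` or `v'(0) = 0` satisfies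
`∫_{a+σ}^∞ |v|² ≤ (K h²/σ^β) ∫₀^∞ |v|²`. -/
theorem stmt_11 (β a σ h K : ℝ) (hβ : 0 < β) (ha : 0 < a) (hσ : 0 < σ) (hh : 0 < h)
    (hK : 0 < K) (lam : ℂ) (him : (lam ^ 2).im ≤ K * h ^ 2)
    (v v' v'' : ℝ → ℂ)
    (hv1 : ∀ x ∈ Ici (0:ℝ), HasDerivWithinAt v (v' x) (Ici 0) x)
    (hv1c : ContinuousOn v' (Ici 0))
    (hvL2 : IntegrableOn (fun x => ‖v x‖ ^ 2) (Ioi 0))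
    (hv'L2 : IntegrableOn (fun x => ‖v' x‖ ^ 2) (Ioi 0))
    (hv2 : ∀ x ∈ Ioo (0:ℝ) a ∪ Ioi a, HasDerivAt v' (v'' x) x)
    (hbc : v 0 = 0 ∨ v' 0 = 0)
    (hode : ∀ x ∈ Ioo (0:ℝ) a ∪ Ioi a,
      -(h:ℂ) ^ 2 * v'' x + Complex.I * (((max (x - a) 0) ^ β : ℝ) : ℂ) * v x
        - lam ^ 2 * v x = 0) :
    ∫ x in Ioi (a + σ), ‖v x‖ ^ 2
      ≤ K * h ^ 2 / σ ^ β * ∫ x in Ioi (0:ℝ), ‖v x‖ ^ 2 := by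
  have hvc : ContinuousOn v (Ici 0) := fun x hx => (hv1 x hx).continuousWithinAt
  set G : ℝ → ℝ := fun x => (v' x * (starRingEnd ℂ) (v x)).im with hG
  set p : ℝ → ℝ := fun x => (max (x - a) 0) ^ β with hp
  have hGc : ContinuousOn G (Ici 0) :=
    Complex.continuous_im.comp_continuousOn
      (hv1c.mul (Complex.continuous_conj.comp_continuousOn hvc))
  have hpc : Continuous p :=
    Continuous.rpow_const (by fun_prop) fun x => Or.inr hβ.le
  have hp0 : ∀ x, 0 ≤ p x := fun x => Real.rpow_nonneg (le_max_right _ _) _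
  have hn : ContinuousOn (fun x => ‖v x‖ ^ 2) (Ici 0) := hvc.norm.pow 2
  have hG0 : G 0 = 0 := by rcases hbc with h0 | h0 <;> simp [hG, h0]
  have hGi : IntegrableOn G (Ioi 0) := by
    refine Integrable.mono' (hvL2.add hv'L2)
      ((hGc.mono Ioi_subset_Ici_self).aestronglyMeasurable measurableSet_Ioi)
      (Filter.Eventually.of_forall fun x => ?_)
    have h1 : ‖G x‖ ≤ ‖v' x‖ * ‖v x‖ := by
      simpa [hG] using Complex.abs_im_le_norm (v' x * (starRingEnd ℂ) (v x))
    simp only [Pi.add_apply]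
    nlinarith [sq_nonneg (‖v' x‖ - ‖v x‖), sq_nonneg (‖v' x‖), sq_nonneg (‖v x‖)]
  have hicc : ∀ {s t : ℝ}, 0 ≤ s → 0 ≤ t → uIcc s t ⊆ Ici 0 := fun hs ht x hx =>
    le_trans (le_min hs ht) hx.1
  have hni : ∀ {s t : ℝ}, 0 ≤ s → 0 ≤ t →
      IntervalIntegrable (fun x => ‖v x‖ ^ 2) volume s t := fun hs ht =>
    (hn.mono (hicc hs ht)).intervalIntegrable
  have hpi : ∀ {s t : ℝ}, 0 ≤ s → 0 ≤ t →
      IntervalIntegrable (fun x => p x * ‖v x‖ ^ 2) volume s t := fun hs ht =>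
    (hpc.continuousOn.mul (hn.mono (hicc hs ht))).intervalIntegrable
  have hflux : ∀ R, 0 ≤ R → (∫ x in (0:ℝ)..R, p x * ‖v x‖ ^ 2)
      - (lam ^ 2).im * (∫ x in (0:ℝ)..R, ‖v x‖ ^ 2) = h ^ 2 * G R := by
    intro R hR
    have key := integral_eq_of_hasDerivAt_off_countable_of_le (fun x => h ^ 2 * G x)
      (fun x => p x * ‖v x‖ ^ 2 - (lam ^ 2).im * ‖v x‖ ^ 2) hR (countable_singleton a)
      ((continuousOn_const.mul hGc).mono Icc_subset_Ici_self) (fun x hx => by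
        have hx' : x ∈ Ioo (0:ℝ) a ∪ Ioi a := by
          rcases lt_or_gt_of_ne (show x ≠ a from hx.2) with hxa | hxa
          · exact Or.inl ⟨hx.1.1, hxa⟩
          · exact Or.inr hxa
        have hd := (hasDerivAt_im_mul_conj ((hv1 x hx.1.1.le).hasDerivAt (Ici_mem_nhds hx.1.1))
          (hv2 x hx')).const_mul (h ^ 2)
        rw [sq_mul_im_mul_conj_eq (hode x hx'), sub_mul] at hd
        exact hd)
      ((hpi le_rfl hR).sub ((hni le_rfl hR).const_mul _))
    rw [intervalIntegral.integral_sub (hpi le_rfl hR) ((hni le_rfl hR).const_mul _),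
      intervalIntegral.integral_const_mul, hG0] at key
    simpa using key
  have has : 0 ≤ a + σ := by positivity
  have hbound : ∀ R, a + σ ≤ R → σ ^ β * (∫ x in (a + σ)..R, ‖v x‖ ^ 2)
      - K * h ^ 2 * (∫ x in (0:ℝ)..R, ‖v x‖ ^ 2) ≤ h ^ 2 * G R := by
    intro R hR
    have hR0 := has.trans hR
    rw [← hflux R hR0,
      ← intervalIntegral.integral_add_adjacent_intervals (hpi le_rfl has) (hpi has hR0)]
    have h1 : 0 ≤ ∫ x in (0:ℝ)..(a + σ), p x * ‖v x‖ ^ 2 :=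
      intervalIntegral.integral_nonneg has fun x _ => mul_nonneg (hp0 x) (sq_nonneg _)
    have h2 : σ ^ β * (∫ x in (a + σ)..R, ‖v x‖ ^ 2)
        ≤ ∫ x in (a + σ)..R, p x * ‖v x‖ ^ 2 := by
      rw [← intervalIntegral.integral_const_mul]
      refine intervalIntegral.integral_mono_on hR ((hni has hR0).const_mul _) (hpi has hR0)
        fun x hx => mul_le_mul_of_nonneg_right ?_ (sq_nonneg _)
      exact Real.rpow_le_rpow hσ.le (le_max_of_le_left (by linarith [hx.1])) hβ.le
    have h3 : 0 ≤ ∫ x in (0:ℝ)..R, ‖v x‖ ^ 2 :=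
      intervalIntegral.integral_nonneg hR0 fun x _ => sq_nonneg _
    linarith [mul_le_mul_of_nonneg_right him h3]
  have hlim := ((intervalIntegral_tendsto_integral_Ioi (a + σ)
      (hvL2.mono_set (Ioi_subset_Ioi has)) Filter.tendsto_id).const_mul (σ ^ β)).sub
    ((intervalIntegral_tendsto_integral_Ioi 0 hvL2 Filter.tendsto_id).const_mul (K * h ^ 2))
  have hle := le_zero_of_tendsto_of_integrableOn_Ioi (hGi.const_mul (h ^ 2)) hlim
    ((Filter.eventually_ge_atTop (a + σ)).mono hbound)
  rw [div_mul_eq_mul_div, le_div_iff₀ (Real.rpow_pos_of_pos hσ β)]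
  linarith
end
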